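/- arXiv:0910.0208 — 2 statements merged into one kernel-verified Lean document; each statement's English description precedes it below -/
import Mathlib

section
/- In the quantum grassmannian O_q(G(m,n)), every consecutive quantum minor [α, α+1, …, α+m−1] (indices read modulo n) quasi-commutes with each of the generating m×m quantum minors: for every m-element subset J of {1,…,n} there is an integer c with [α,…,α+m−1][J] = q^c [J][α,…,α+m−1]. In particular, each consecutive quantum minor is a normal element of O_q(G(m,n)). -/
open scoped BigOperators

namespace QG

variable (K : Type*) [Field K]

/-- The defining relations of the quantum matrix algebra `O_q(M_{m,n})`. -/
inductive QMatRel (q : K) (m n : ℕ) :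
    FreeAlgebra K (Fin m × Fin n) → FreeAlgebra K (Fin m × Fin n) → Prop
  | row : ∀ (i : Fin m) (j l : Fin n), j < l →
      QMatRel q m n (FreeAlgebra.ι K (i, j) * FreeAlgebra.ι K (i, l))
        (q • (FreeAlgebra.ι K (i, l) * FreeAlgebra.ι K (i, j)))
  | col : ∀ (i k : Fin m) (j : Fin n), i < k →
      QMatRel q m n (FreeAlgebra.ι K (i, j) * FreeAlgebra.ι K (k, j))
        (q • (FreeAlgebra.ι K (k, j) * FreeAlgebra.ι K (i, j)))
  | comm : ∀ (i k : Fin m) (j l : Fin n), k < i → j < l →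
      QMatRel q m n (FreeAlgebra.ι K (i, j) * FreeAlgebra.ι K (k, l))
        (FreeAlgebra.ι K (k, l) * FreeAlgebra.ι K (i, j))
  | qrel : ∀ (i k : Fin m) (j l : Fin n), i < k → j < l →
      QMatRel q m n
        (FreeAlgebra.ι K (i, j) * FreeAlgebra.ι K (k, l) -
          FreeAlgebra.ι K (k, l) * FreeAlgebra.ι K (i, j))
        ((q - q⁻¹) • (FreeAlgebra.ι K (i, l) * FreeAlgebra.ι K (k, j)))

/-- The quantum matrix algebra `O_q(M_{m,n})`. -/
abbrev QMat (q : K) (m n : ℕ) := RingQuot (QMatRel K q m n)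

/-- The generator `X_{ij}` of `O_q(M_{m,n})`. -/
noncomputable def X (q : K) {m n : ℕ} (i : Fin m) (j : Fin n) : QMat K q m n :=
  RingQuot.mkAlgHom K (QMatRel K q m n) (FreeAlgebra.ι K (i, j))

/-- The number of inversions (Coxeter length) of a permutation of `Fin t`. -/
def invCount {t : ℕ} (σ : Equiv.Perm (Fin t)) : ℕ :=
  ((Finset.univ : Finset (Fin t × Fin t)).filter fun p => p.1 < p.2 ∧ σ p.2 < σ p.1).card

/-- The quantum minor `Σ_σ (-q)^{ℓ(σ)} x_{σ(1)1} ⋯ x_{σ(t)t}` of a `t × t`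
matrix of elements of a `K`-algebra. -/
noncomputable def qMinor {A : Type*} [Ring A] [Algebra K A] (q : K) (t : ℕ)
    (x : Fin t → Fin t → A) : A :=
  ∑ σ : Equiv.Perm (Fin t), ((-q) ^ invCount σ) • (List.ofFn fun k => x (σ k) k).prod

/-- The maximal (`m × m`) quantum minor `[J]` of `O_q(M_{m,n})`, with column index set `J`
(columns taken in increasing order, rows `1,…,m`).  (Defined to be `0` if `J` does not
have exactly `m` elements.) -/
noncomputable def grMinor (q : K) (m : ℕ) {n : ℕ} (J : Finset (Fin n)) : QMat K q m n :=
  if h : J.card = m then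
    qMinor K q m (fun i k => X K q i (J.orderEmbOfFin h k)) else 0

/-- The set of maximal quantum minors of `O_q(M_{m,n})`. -/
def grGenSet (q : K) (m n : ℕ) : Set (QMat K q m n) :=
  {a | ∃ J : Finset (Fin n), a = grMinor K q m J}

/-- The quantum grassmannian `O_q(G(m,n))`: the subalgebra of `O_q(M_{m,n})`
generated by the maximal quantum minors. -/
noncomputable def qGrass (q : K) (m n : ℕ) : Subalgebra K (QMat K q m n) :=
  Algebra.adjoin K (grGenSet K q m n)

/-- The maximal quantum minor `[J]` viewed as an element of the quantum grassmannian. -/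
noncomputable def grE (q : K) (m : ℕ) {n : ℕ} (J : Finset (Fin n)) : ↥(qGrass K q m n) :=
  ⟨grMinor K q m J, Algebra.subset_adjoin ⟨J, rfl⟩⟩

/-- Reduction of a natural number modulo `n`, landing in `Fin n` (this encodes the
paper's convention that a column index is read modulo `n`; indices here are 0-based). -/
def fmod (n : ℕ) (hn : 0 < n) (k : ℕ) : Fin n := ⟨k % n, Nat.mod_lt k hn⟩

/-- The index set `{α, α+1, …, α+m-1}` (read modulo `n`) of a consecutive quantum minor
(0-based indices). -/
def consecSet {n : ℕ} (hn : 0 < n) (m : ℕ) (α : ℕ) : Finset (Fin n) :=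
  (Finset.range m).image fun k => fmod n hn (α + k)

end QG
namespace QG

variable (K : Type*) [Field K]

/-- Localisation of a `K`-algebra `A` at the powers of a normal element `u`:
an algebra `B` together with an injective map `A → B` inverting `u`, such that every
element of `B` has the form `a·u^{-k}`. -/
structure NormalLoc (A : Type*) [Ring A] [Algebra K A]
    (B : Type*) [Ring B] [Algebra K B] (u : A) where
  emb : A →ₐ[K] B
  inj : Function.Injective emb
  isUnit : IsUnit (emb u)
  surj : ∀ b : B, ∃ (a : A) (k : ℕ), b = emb a * ↑(isUnit.unit⁻¹ ^ k)

/-- The index set (0-based) of the quantum minor defining the dehomogenisation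
generator `x_{ij}` at the consecutive minor starting at `α`:
`M_α ∪ {~(α+m+j)} ∖ {~(α+(m-1-i))}`. -/
def JxSet {n : ℕ} (hn : 0 < n) (m : ℕ) (α : ℕ) (i : Fin m) (j : Fin (n - m)) :
    Finset (Fin n) :=
  insert (fmod n hn (α + m + j)) ((consecSet hn m α).erase (fmod n hn (α + (m - 1 - i))))

/-- The generator `x_{ij} = [M_α ∪ {~(α+m+j)} ∖ {~(α+(m-1-i))}]·M_α^{-1}` of the
dehomogenisation of the quantum grassmannian at the consecutive minor `M_α`. -/
noncomputable def xElt (q : K) (m n : ℕ) (hn : 0 < n) (α : ℕ)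
    {B : Type*} [Ring B] [Algebra K B]
    (L : NormalLoc K (↥(qGrass K q m n)) B (grE K q m (consecSet hn m α)))
    (i : Fin m) (j : Fin (n - m)) : B :=
  L.emb (grE K q m (JxSet hn m α i j)) * ↑(L.isUnit.unit⁻¹)

/-- `B` is a skew-Laurent extension `R[y^{±1};σ]` of the subalgebra `R`, where `σ` is
conjugation by the unit `y`:  `R` is stable under conjugation by `y` and `B` is free as a
left `R`-module with basis the (integer) powers of `y`. -/
def IsSkewLaurent {B : Type*} [Ring B] [Algebra K B] (R : Subalgebra K B) (y : Bˣ) : Prop :=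
  (∀ r ∈ R, (y : B) * r * ((y⁻¹ : Bˣ) : B) ∈ R) ∧
    ∀ b : B, ∃! f : ℤ →₀ ↥R, b = f.sum fun k r => (r : B) * ((y ^ k : Bˣ) : B)

/-- The quantum minor of a matrix of elements with row index set `R` and column index
set `C` (rows and columns taken in increasing order); `0` if the cardinalities differ. -/
noncomputable def finsetMinor {B : Type*} [Ring B] [Algebra K B] (q : K) {m c : ℕ}
    (x : Fin m → Fin c → B) (R : Finset (Fin m)) (C : Finset (Fin c)) : B :=
  if h : C.card = R.card then
    qMinor K q R.card (fun a b => x (R.orderEmbOfFin rfl a) (C.orderEmbOfFin h b))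
  else 0

/-- The row set `(α+m) − (M_α ∖ I_r)` (0-based) of the image of the maximal minor `[I]`
under the dehomogenisation at `M_α`. -/
def rowSetOf {n : ℕ} (hn : 0 < n) (m : ℕ) (α : ℕ) (I : Finset (Fin n)) : Finset (Fin m) :=
  (Finset.univ.filter fun k : Fin m => fmod n hn (α + k) ∉ I).image Fin.rev

/-- The column set `I_c − (α+m−1)` (0-based) of the image of the maximal minor `[I]`
under the dehomogenisation at `M_α`. -/
def colSetOf {n : ℕ} (hn : 0 < n) (m : ℕ) (α : ℕ) (I : Finset (Fin n)) :
    Finset (Fin (n - m)) :=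
  Finset.univ.filter fun d : Fin (n - m) => fmod n hn (α + m + d) ∈ I

/-- The last index (0-based, corresponding to the paper's index `n`). -/
def lastIdx (n : ℕ) (hn : 0 < n) : Fin n := ⟨n - 1, by omega⟩

/-- The 2-cocycle `c((s_1,…,s_n),(t_1,…,t_n)) = ∏_{j ≠ n} p^{s_n t_j}` on `ℤ^n`. -/
noncomputable def cmap {n : ℕ} (hn : 0 < n) (p : K) :
    (Fin n → ℤ) → (Fin n → ℤ) → K := fun s t =>
  ∏ j ∈ Finset.univ.filter (fun j : Fin n => j ≠ lastIdx n hn),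
    p ^ (s (lastIdx n hn) * t j)

/-- The content `ε(j+m) − ε(m+1−i)` of the dehomogenisation generator `x_{ij}`
(0-based: `ε(m+j) − ε(m-1-i)`). -/
def xContent (m n : ℕ) (i : Fin m) (j : Fin (n - m)) : Fin n → ℤ := fun l =>
  (if (l : ℕ) = m + j then 1 else 0) - (if (l : ℕ) = m - 1 - i then 1 else 0)

/-- The content `ε(1) + ⋯ + ε(m)` of `y` (equivalently, of a consecutive minor `M_1`). -/
def yContent (m n : ℕ) : Fin n → ℤ := fun l => if (l : ℕ) < m then 1 else 0

/-- The content `Σ_{i ∈ I} ε(i)` of a maximal quantum minor `[I]`. -/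
def contentOf {n : ℕ} (I : Finset (Fin n)) : Fin n → ℤ := fun l => if l ∈ I then 1 else 0

/-- A realization of the twist `T(A)` of a `ℤ^n`-graded `K`-algebra `A` by a
2-cocycle `c`: a `K`-algebra `T` together with a `K`-linear isomorphism `τ : A ≃ T`
(the twist map `a ↦ a'`) satisfying `a'b' = c(s,t)·(ab)'` on homogeneous elements. -/
structure CocycleTwist {n : ℕ} (A : Type*) [Ring A] [Algebra K A]
    (𝒜 : (Fin n → ℤ) → Submodule K A) (c : (Fin n → ℤ) → (Fin n → ℤ) → K)
    (T : Type*) [Ring T] [Algebra K T] where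
  τ : A ≃ₗ[K] T
  mul_tw : ∀ (s t : Fin n → ℤ) (a b : A), a ∈ 𝒜 s → b ∈ 𝒜 t →
    τ a * τ b = c s t • τ (a * b)

/-- The image of an index set under the cycle `(1 2 … n)` (0-based). -/
def shiftSet {n : ℕ} (hn : 0 < n) (I : Finset (Fin n)) : Finset (Fin n) :=
  I.image fun a : Fin n => fmod n hn (a.val + 1)

end QG
namespace QG

section Aux

variable {K : Type*} [Field K] {q : K} {m n : ℕ}

theorem X_row (i : Fin m) {j l : Fin n} (h : j < l) :
    X K q i j * X K q i l = q • (X K q i l * X K q i j) := by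
  have := RingQuot.mkAlgHom_rel K (QMatRel.row (q := q) i j l h)
  simpa [X] using this

theorem X_col {i k : Fin m} (j : Fin n) (h : i < k) :
    X K q i j * X K q k j = q • (X K q k j * X K q i j) := by
  have := RingQuot.mkAlgHom_rel K (QMatRel.col (q := q) i k j h)
  simpa [X] using this

theorem X_comm {i k : Fin m} {j l : Fin n} (h : k < i) (h' : j < l) :
    X K q i j * X K q k l = X K q k l * X K q i j := by
  have := RingQuot.mkAlgHom_rel K (QMatRel.comm (q := q) i k j l h h')
  simpa [X] using this

theorem X_qrel {i k : Fin m} {j l : Fin n} (h : i < k) (h' : j < l) :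
    X K q i j * X K q k l - X K q k l * X K q i j =
      (q - q⁻¹) • (X K q i l * X K q k j) := by
  have := RingQuot.mkAlgHom_rel K (QMatRel.qrel (q := q) i k j l h h')
  simpa only [X, map_mul, map_sub, map_smul] using this

/-- A family of elements satisfying the quantum matrix relations. -/
structure Good {B : Type*} [Ring B] [Algebra K B] (q : K) (f : Fin m → Fin n → B) : Prop where
  row : ∀ (i : Fin m) (j l : Fin n), j < l → f i j * f i l = q • (f i l * f i j)
  col : ∀ (i k : Fin m) (j : Fin n), i < k → f i j * f k j = q • (f k j * f i j)
  comm : ∀ (i k : Fin m) (j l : Fin n), k < i → j < l → f i j * f k l = f k l * f i j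
  qrel : ∀ (i k : Fin m) (j l : Fin n), i < k → j < l →
    f i j * f k l - f k l * f i j = (q - q⁻¹) • (f i l * f k j)

theorem exists_lift {B : Type*} [Ring B] [Algebra K B] {f : Fin m → Fin n → B}
    (h : Good q f) : ∃ φ : QMat K q m n →ₐ[K] B, ∀ i j, φ (X K q i j) = f i j := by
  refine ⟨RingQuot.liftAlgHom K ⟨FreeAlgebra.lift K (fun p => f p.1 p.2), ?_⟩, ?_⟩
  · intro a b hab
    cases hab with
    | row i j l hl => simpa using h.row i j l hl
    | col i k j hl => simpa using h.col i k j hl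
    | comm i k j l h1 h2 => simpa using h.comm i k j l h1 h2
    | qrel i k j l h1 h2 =>
      simpa only [map_mul, map_sub, map_smul, FreeAlgebra.lift_ι_apply] using h.qrel i k j l h1 h2
  · intro i j
    simp [X, RingQuot.liftAlgHom_mkAlgHom_apply]

/-- Upper triangular `2 × 2` matrices. -/
def tri {A : Type*} [Zero A] (a b d : A) : Matrix (Fin 2) (Fin 2) A := !![a, b; 0, d]

theorem tri_mul {A : Type*} [Ring A] (a b d a' b' d' : A) :
    tri a b d * tri a' b' d' = tri (a * a') (a * b' + b * d') (d * d') := by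
  ext i j
  fin_cases i <;> fin_cases j <;> simp [tri, Matrix.mul_apply, Fin.sum_univ_two]

theorem tri_one {A : Type*} [Ring A] : (1 : Matrix (Fin 2) (Fin 2) A) = tri 1 0 1 := by
  ext i j
  fin_cases i <;> fin_cases j <;> simp [tri]

theorem tri_sub {A : Type*} [Ring A] (a b d a' b' d' : A) :
    tri a b d - tri a' b' d' = tri (a - a') (b - b') (d - d') := by
  ext i j
  fin_cases i <;> fin_cases j <;> simp [tri]

theorem tri_smul {A : Type*} [Ring A] [Algebra K A] (c : K) (a b d : A) :
    c • tri a b d = tri (c • a) (c • b) (c • d) := by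
  ext i j
  fin_cases i <;> fin_cases j <;> simp [tri]

/-- `u` and `v` are adjacent, and `p` is the corresponding power of `q`. -/
def Adj (q : K) {n : ℕ} (u v : Fin n) (p : K) : Prop :=
  (v.val = u.val + 1 ∧ p = q) ∨ (u.val = v.val + 1 ∧ p = q⁻¹)

/-- Scaling factor. -/
noncomputable def sc (p : K) {n : ℕ} (u v j : Fin n) : K :=
  if j = u then p else if j = v then p⁻¹ else 1

/-- images of the generators under the column skew derivation. -/
noncomputable def colF (q p : K) (u v : Fin n) (i : Fin m) (j : Fin n) :
    Matrix (Fin 2) (Fin 2) (QMat K q m n) :=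
  tri (sc p u v j • X K q i j) (if j = u then X K q i v else 0) (X K q i j)

theorem colF_good (hq : q ≠ 0) {p : K} {u v : Fin n} (h : Adj q u v p) :
    Good q (colF (m := m) q p u v) := by
  have huv : u ≠ v := by
    rintro rfl
    rcases h with ⟨h, _⟩ | ⟨h, _⟩ <;> omega
  have su : sc p u v u = p := by simp [sc]
  have sv : sc p u v v = p⁻¹ := by simp [sc, huv.symm]
  have so : ∀ j, j ≠ u → j ≠ v → sc p u v j = 1 := fun j h1 h2 => by simp [sc, h1, h2]
  constructor
  · intro i j l hjl
    simp only [colF, tri_mul, tri_smul]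
    congr 1
    · simp only [smul_mul_smul_comm, X_row i hjl]
      module
    · by_cases hju : j = u
      · subst hju
        have hlj : l ≠ j := hjl.ne'
        simp only [hlj, if_true, if_false, mul_zero, zero_mul, zero_add, add_zero]
        by_cases hlv : l = v
        · subst hlv
          rcases h with ⟨h1, rfl⟩ | ⟨h1, rfl⟩
          · rw [sv, smul_mul_assoc, smul_inv_smul₀ hq]
          · exact absurd hjl (by rw [Fin.lt_def]; omega)
        · have : v < l := by
            rcases h with ⟨h1, rfl⟩ | ⟨h1, rfl⟩ <;> rw [Fin.lt_def] at * <;> omega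
          rw [so l hlj hlv, one_smul, X_row i this]
      · simp only [hju, if_false, mul_zero, zero_mul, zero_add, add_zero]
        by_cases hlu : l = u
        · subst hlu
          simp only [if_true]
          by_cases hjv : j = v
          · subst hjv
            rcases h with ⟨h1, rfl⟩ | ⟨h1, rfl⟩
            · exact absurd hjl (by rw [Fin.lt_def]; omega)
            · rw [sv, inv_inv, smul_mul_assoc]
          · have : j < v := by
              rcases h with ⟨h1, rfl⟩ | ⟨h1, rfl⟩ <;> rw [Fin.lt_def] at * <;> omega
            rw [so j hju hjv, one_smul, X_row i this]
        · simp [hlu]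
    · exact X_row i hjl
  · intro i k j hik
    simp only [colF, tri_mul, tri_smul]
    congr 1
    · simp only [smul_mul_smul_comm, X_col j hik]
      module
    · by_cases hju : j = u
      · subst hju
        simp only [if_true, su]
        rcases h with ⟨h1, rfl⟩ | ⟨h1, rfl⟩
        · have hlt : j < v := by rw [Fin.lt_def]; omega
          have e1 := X_comm (K := K) (q := p) hik hlt
          have e2 := X_qrel (K := K) (q := p) hik hlt
          simp only [smul_mul_assoc, e1]
          rw [sub_eq_iff_eq_add] at e2
          rw [e2]
          match_scalars <;> field_simp <;> ring
        · have hlt : v < j := by rw [Fin.lt_def]; omega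
          have e1 := X_comm (K := K) (q := q) hik hlt
          have e2 := X_qrel (K := K) (q := q) hik hlt
          simp only [smul_mul_assoc, e1]
          rw [sub_eq_iff_eq_add] at e2
          rw [e2]
          match_scalars <;> field_simp <;> ring
      · simp [hju]
    · exact X_col j hik
  · intro i k j l hki hjl
    simp only [colF, tri_mul]
    congr 1
    · simp only [smul_mul_smul_comm, X_comm hki hjl]
      module
    · by_cases hju : j = u
      · subst hju
        have hlj : l ≠ j := hjl.ne'
        simp only [hlj, if_true, if_false, mul_zero, zero_mul, zero_add, add_zero]
        by_cases hlv : l = v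
        · subst hlv
          rcases h with ⟨h1, rfl⟩ | ⟨h1, rfl⟩
          · rw [sv, smul_mul_assoc, X_col l hki, inv_smul_smul₀ hq]
          · exact absurd hjl (by rw [Fin.lt_def]; omega)
        · have : v < l := by
            rcases h with ⟨h1, rfl⟩ | ⟨h1, rfl⟩ <;> rw [Fin.lt_def] at * <;> omega
          rw [so l hlj hlv, one_smul, X_comm hki this]
      · simp only [hju, if_false, mul_zero, zero_mul, zero_add, add_zero]
        by_cases hlu : l = u
        · subst hlu
          simp only [if_true]
          by_cases hjv : j = v
          · subst hjv
            rcases h with ⟨h1, rfl⟩ | ⟨h1, rfl⟩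
            · exact absurd hjl (by rw [Fin.lt_def]; omega)
            · rw [sv, inv_inv, smul_mul_assoc, X_col j hki]
          · have : j < v := by
              rcases h with ⟨h1, rfl⟩ | ⟨h1, rfl⟩ <;> rw [Fin.lt_def] at * <;> omega
            rw [so j hju hjv, one_smul, X_comm hki this]
        · simp [hlu]
    · exact X_comm hki hjl
  · intro i k j l hik hjl
    simp only [colF, tri_mul, tri_sub, tri_smul]
    congr 1
    · simp only [smul_mul_smul_comm]
      have e := X_qrel (K := K) (q := q) hik hjl
      rw [sub_eq_iff_eq_add] at e
      rw [e]
      module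
    · by_cases hju : j = u
      · subst hju
        have hlj : l ≠ j := hjl.ne'
        simp only [hlj, if_true, if_false, mul_zero, zero_mul, zero_add, add_zero]
        by_cases hlv : l = v
        · subst hlv
          rcases h with ⟨h1, rfl⟩ | ⟨h1, rfl⟩
          · rw [sv, smul_mul_assoc, smul_mul_assoc, X_col l hik]
            match_scalars <;> field_simp
          · exact absurd hjl (by rw [Fin.lt_def]; omega)
        · have : v < l := by
            rcases h with ⟨h1, rfl⟩ | ⟨h1, rfl⟩ <;> rw [Fin.lt_def] at * <;> omega
          rw [so l hlj hlv, one_smul, one_smul, X_qrel hik this]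
      · simp only [hju, if_false, mul_zero, zero_mul, zero_add, add_zero]
        by_cases hlu : l = u
        · subst hlu
          simp only [if_true]
          by_cases hjv : j = v
          · subst hjv
            rcases h with ⟨h1, rfl⟩ | ⟨h1, rfl⟩
            · exact absurd hjl (by rw [Fin.lt_def]; omega)
            · rw [sv, inv_inv, smul_mul_assoc, X_col j hik]
              match_scalars <;> field_simp
          · have : j < v := by
              rcases h with ⟨h1, rfl⟩ | ⟨h1, rfl⟩ <;> rw [Fin.lt_def] at * <;> omega
            rw [so j hju hjv, one_smul, X_qrel hik this]
        · simp [hlu]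
    · exact X_qrel hik hjl

theorem transpose_good : Good q (fun (i : Fin m) (j : Fin n) => X K q j i) where
  row i j l h := X_col i h
  col i k j h := X_row j h
  comm i k j l h h' := (X_comm h' h).symm
  qrel i k j l h h' := by rw [X_qrel h' h, X_comm h' h]

/-- Images of the generators under the row skew derivation. -/
noncomputable def rowF (q p : K) (u v : Fin m) (i : Fin m) (j : Fin n) :
    Matrix (Fin 2) (Fin 2) (QMat K q m n) :=
  tri (sc p u v i • X K q i j) (if i = u then X K q v j else 0) (X K q i j)

theorem exists_colHom (hq : q ≠ 0) {p : K} {u v : Fin n} (h : Adj q u v p) :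
    ∃ φ : QMat K q m n →ₐ[K] Matrix (Fin 2) (Fin 2) (QMat K q m n),
      ∀ i j, φ (X K q i j) = colF q p u v i j :=
  exists_lift (colF_good hq h)

theorem exists_rowHom (hq : q ≠ 0) {p : K} {u v : Fin m} (h : Adj q u v p) :
    ∃ φ : QMat K q m n →ₐ[K] Matrix (Fin 2) (Fin 2) (QMat K q m n),
      ∀ i j, φ (X K q i j) = rowF q p u v i j := by
  obtain ⟨φ, hφ⟩ := exists_colHom (m := n) hq h
  obtain ⟨t, ht⟩ := exists_lift (transpose_good (K := K) (q := q) (m := m) (n := n))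
  obtain ⟨t', ht'⟩ := exists_lift (transpose_good (K := K) (q := q) (m := n) (n := m))
  refine ⟨(t'.mapMatrix.comp φ).comp t, fun i j => ?_⟩
  simp only [AlgHom.comp_apply, ht, hφ, colF, rowF, AlgHom.mapMatrix_apply]
  ext a b
  fin_cases a <;> fin_cases b <;> simp [tri, ht', apply_ite t']

theorem prod_tri_zero {A : Type*} [Ring A] [Algebra K A] : ∀ {m : ℕ} (s : Fin m → K)
    (d : Fin m → A),
    (List.ofFn fun k => tri (s k • d k) 0 (d k)).prod =
      tri ((∏ k, s k) • (List.ofFn d).prod) 0 (List.ofFn d).prod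
  | 0, s, d => by simp [tri_one]
  | m + 1, s, d => by
    rw [List.ofFn_succ, List.prod_cons, prod_tri_zero (fun k => s k.succ) (fun k => d k.succ),
      tri_mul, List.ofFn_succ, List.prod_cons, Fin.prod_univ_succ, smul_mul_smul_comm]
    simp

theorem prod_tri {A : Type*} [Ring A] [Algebra K A] : ∀ {m : ℕ} (s : Fin m → K)
    (d b : Fin m → A) (k0 : Fin m), (∀ k, k ≠ k0 → b k = 0) →
    (List.ofFn fun k => tri (s k • d k) (b k) (d k)).prod =
      tri ((∏ k, s k) • (List.ofFn d).prod)
        ((∏ k, if k < k0 then s k else 1) • (List.ofFn (Function.update d k0 (b k0))).prod)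
        (List.ofFn d).prod
  | 0, s, d, b, k0, hb => k0.elim0
  | m + 1, s, d, b, k0, hb => by
    induction k0 using Fin.cases with
    | zero =>
      have h0 : ∀ k : Fin m, b k.succ = 0 := fun k => hb _ (Fin.succ_ne_zero k)
      rw [List.ofFn_succ, List.prod_cons]
      simp only [h0]
      rw [prod_tri_zero (fun k => s k.succ) (fun k => d k.succ),
        tri_mul, List.ofFn_succ, List.prod_cons, Fin.prod_univ_succ, smul_mul_smul_comm,
        List.ofFn_succ, List.prod_cons]
      simp
    | succ k1 =>
      have h0 : b 0 = 0 := hb _ (Fin.succ_ne_zero k1).symm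
      rw [List.ofFn_succ, List.prod_cons, prod_tri (fun k => s k.succ) (fun k => d k.succ)
        (fun k => b k.succ) k1 (fun k hk => hb _ (fun h => hk (Fin.succ_injective _ h))),
        tri_mul, List.ofFn_succ, List.prod_cons, Fin.prod_univ_succ, smul_mul_smul_comm,
        List.ofFn_succ, List.prod_cons, h0, zero_mul, add_zero, Fin.prod_univ_succ]
      have e1 : Function.update d k1.succ (b k1.succ) 0 = d 0 :=
        Function.update_of_ne (Fin.succ_ne_zero k1).symm _ _
      have e2 : (fun k : Fin m => Function.update d k1.succ (b k1.succ) k.succ) =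
          Function.update (fun k => d k.succ) k1 (b k1.succ) := by
        funext k
        by_cases hk : k = k1
        · subst hk; simp
        · rw [Function.update_of_ne hk,
            Function.update_of_ne (fun h => hk (Fin.succ_injective _ h))]
      rw [e1, e2, smul_mul_smul_comm]
      simp only [Fin.succ_pos, if_true, Fin.succ_lt_succ_iff]

theorem ofFn_pair {A : Type*} [Ring A] [Algebra K A] : ∀ {m : ℕ} (g h : Fin m → A)
    (k l : Fin m), l.val = k.val + 1 → (∀ i, i ≠ k → i ≠ l → g i = h i) → ∀ (c : K),
    g k * g l = c • (h k * h l) → (List.ofFn g).prod = c • (List.ofFn h).prod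
  | 0, g, h, k, l, hl, hgh, c, hc => k.elim0
  | m + 1, g, h, k, l, hl, hgh, c, hc => by
    induction l using Fin.cases with
    | zero => simp at hl
    | succ l' =>
    induction k using Fin.cases with
    | zero =>
      obtain ⟨m', rfl⟩ : ∃ m', m = m' + 1 := ⟨m - 1, by have := l'.2; omega⟩
      have hl0 : l' = 0 := by
        apply Fin.ext
        simpa using hl
      subst hl0
      simp only [List.ofFn_succ, List.prod_cons]
      rw [← mul_assoc, hc, ← mul_assoc, smul_mul_assoc]
      congr 3
      congr 1
      funext i
      exact hgh _ (Fin.succ_ne_zero _)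
        (fun h => Fin.succ_ne_zero _ (Fin.succ_injective _ h))
    | succ k' =>
      rw [List.ofFn_succ, List.prod_cons, List.ofFn_succ, List.prod_cons,
        ofFn_pair (fun i => g i.succ) (fun i => h i.succ) k' l' (by simpa using hl)
          (fun i h1 h2 => hgh _ (fun h => h1 (Fin.succ_injective _ h))
            (fun h => h2 (Fin.succ_injective _ h))) c hc,
        hgh 0 (Fin.succ_ne_zero _).symm (Fin.succ_ne_zero _).symm, mul_smul_comm]

theorem ofFn_qcomm {A : Type*} [Ring A] [Algebra K A] : ∀ {m : ℕ} (x : A) (g : Fin m → A)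
    (c : Fin m → K), (∀ k, x * g k = c k • (g k * x)) →
    x * (List.ofFn g).prod = (∏ k, c k) • ((List.ofFn g).prod * x)
  | 0, x, g, c, h => by simp
  | m + 1, x, g, c, h => by
    rw [List.ofFn_succ, List.prod_cons, ← mul_assoc, h 0, smul_mul_assoc, mul_assoc,
      ofFn_qcomm x (fun k => g k.succ) (fun k => c k.succ) (fun k => h k.succ),
      Fin.prod_univ_succ, mul_smul_comm, smul_smul, mul_assoc]

theorem swap_lt_swap {t : ℕ} {k l a b : Fin t} (hl : l.val = k.val + 1)
    (h1 : ¬ (a = k ∧ b = l)) (h2 : ¬ (a = l ∧ b = k)) :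
    Equiv.swap k l a < Equiv.swap k l b ↔ a < b := by
  simp only [Equiv.swap_apply_def, Fin.lt_def, Fin.ext_iff] at *
  split_ifs <;> omega

theorem invCount_mul_swap {t : ℕ} (σ : Equiv.Perm (Fin t)) {k l : Fin t}
    (hl : l.val = k.val + 1) (h : σ k < σ l) :
    invCount (σ * Equiv.swap k l) = invCount σ + 1 := by
  have hkl : k < l := by rw [Fin.lt_def]; omega
  have key : ((Finset.univ : Finset (Fin t × Fin t)).filter fun p =>
      p.1 < p.2 ∧ (σ * Equiv.swap k l) p.2 < (σ * Equiv.swap k l) p.1) =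
      insert (k, l) (((Finset.univ : Finset (Fin t × Fin t)).filter fun p =>
        p.1 < p.2 ∧ σ p.2 < σ p.1).map
          ((Equiv.swap k l).prodCongr (Equiv.swap k l)).toEmbedding) := by
    ext ⟨a, b⟩
    rw [Finset.mem_insert, Finset.mem_map_equiv, Finset.mem_filter, Finset.mem_filter]
    simp only [Finset.mem_univ, true_and, Equiv.Perm.mul_apply,
      Prod.mk.injEq, Equiv.prodCongr_symm,
      Equiv.symm_swap, Equiv.prodCongr_apply, Prod.map_fst, Prod.map_snd]
    by_cases h1 : a = k ∧ b = l
    · obtain ⟨rfl, rfl⟩ := h1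
      simp [hkl, h]
    · by_cases h2 : a = l ∧ b = k
      · obtain ⟨rfl, rfl⟩ := h2
        simp [hkl.not_gt, h.not_gt, hkl.ne']
      · rw [swap_lt_swap hl h1 h2]
        simp [h1]
  unfold invCount
  rw [key, Finset.card_insert_of_notMem, Finset.card_map]
  simp [Finset.mem_map_equiv, hkl.not_gt]

theorem invCount_inv {t : ℕ} (σ : Equiv.Perm (Fin t)) : invCount σ⁻¹ = invCount σ := by
  unfold invCount
  refine Finset.card_bij' (fun p _ => (σ⁻¹ p.2, σ⁻¹ p.1)) (fun p _ => (σ p.2, σ p.1)) ?_ ?_ ?_ ?_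
  all_goals simp +contextual

theorem invCount_swap_mul {t : ℕ} (σ : Equiv.Perm (Fin t)) {u v : Fin t}
    (hv : v.val = u.val + 1) (h : σ⁻¹ u < σ⁻¹ v) :
    invCount (Equiv.swap u v * σ) = invCount σ + 1 := by
  rw [← invCount_inv, mul_inv_rev, Equiv.swap_inv, invCount_mul_swap _ hv h, invCount_inv]

/-- The maximal minor with an arbitrary sequence of columns. -/
noncomputable def minor (q : K) (e : Fin m → Fin n) : QMat K q m n :=
  qMinor K q m (fun i k => X K q i (e k))

theorem minor_eq_zero (e : Fin m → Fin n) {k l : Fin m} (hl : l.val = k.val + 1)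
    (he : e k = e l) : minor q e = 0 := by
  have hkl : k ≠ l := by
    rintro rfl
    omega
  have main : ∀ σ : Equiv.Perm (Fin m), σ k < σ l →
      ((-q) ^ invCount σ) • (List.ofFn fun k => X K q (σ k) (e k)).prod +
      ((-q) ^ invCount (σ * Equiv.swap k l)) •
        (List.ofFn fun i => X K q ((σ * Equiv.swap k l) i) (e i)).prod = 0 := by
    intro σ hσ
    rw [invCount_mul_swap σ hl hσ,
      ofFn_pair (fun k => X K q (σ k) (e k)) (fun i => X K q ((σ * Equiv.swap k l) i) (e i))
      k l hl (fun i h1 h2 => by simp [Equiv.swap_apply_of_ne_of_ne h1 h2]) q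
      (by simpa [he] using X_col (e l) hσ)]
    module
  unfold minor qMinor
  refine Finset.sum_involution (fun σ _ => σ * Equiv.swap k l) ?_ ?_ ?_ ?_
  · intro σ _
    rcases lt_or_gt_of_ne (fun h => hkl (σ.injective h) : σ k ≠ σ l) with h | h
    · exact main σ h
    · have := main (σ * Equiv.swap k l) (by simpa using h)
      rw [mul_assoc, Equiv.swap_mul_self, mul_one, add_comm] at this
      exact this
  · intro σ _ _ h
    have := congrArg (fun τ : Equiv.Perm (Fin m) => τ k) h
    simp at this
    exact hkl this.symm
  · intros; simp
  · intros; simp [mul_assoc]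

theorem tri_sum {A ι : Type*} [Ring A] (s : Finset ι) (a b d : ι → A) :
    ∑ i ∈ s, tri (a i) (b i) (d i) = tri (∑ i ∈ s, a i) (∑ i ∈ s, b i) (∑ i ∈ s, d i) := by
  ext i j
  fin_cases i <;> fin_cases j <;> simp [tri, Matrix.sum_apply]

theorem colHom_minor {p : K} {u v : Fin n}
    {φ : QMat K q m n →ₐ[K] Matrix (Fin 2) (Fin 2) (QMat K q m n)}
    (hφ : ∀ i j, φ (X K q i j) = colF q p u v i j) (e : Fin m → Fin n) (k0 : Fin m)
    (h0 : e k0 = u) (h1 : ∀ k, k ≠ k0 → e k ≠ u) :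
    φ (minor q e) = tri ((∏ k, sc p u v (e k)) • minor q e)
      ((∏ k, if k < k0 then sc p u v (e k) else 1) • minor q (Function.update e k0 v))
      (minor q e) := by
  unfold minor qMinor
  simp only [map_sum, map_smul, map_list_prod, List.map_ofFn, Function.comp_def, hφ, colF]
  rw [Finset.smul_sum, Finset.smul_sum, ← tri_sum]
  refine Finset.sum_congr rfl fun σ _ => ?_
  rw [prod_tri (fun k => sc p u v (e k)) (fun k => X K q (σ k) (e k))
    (fun k => if e k = u then X K q (σ k) v else 0) k0 (fun k hk => by simp [h1 k hk]), tri_smul,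
    smul_comm, smul_comm (_ ^ _)]
  congr 4
  congr 1
  funext k
  by_cases hk : k = k0
  · subst hk; simp [h0]
  · simp [Function.update_of_ne hk]

theorem prod_sc {p : K} (hp : p ≠ 0) {u v : Fin n} (huv : u ≠ v) (e : Fin m → Fin n)
    {k l : Fin m} (hk : e k = u) (hl : e l = v) (he : Function.Injective e) :
    ∏ k, sc p u v (e k) = 1 := by
  have hkl : k ≠ l := by
    rintro rfl
    exact huv (hk.symm.trans hl)
  rw [Fintype.prod_eq_mul k l hkl]
  · simp [sc, hk, hl, huv.symm, hp]
  · rintro x ⟨h1, h2⟩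
    have h1' : e x ≠ u := fun h => h1 (he (h.trans hk.symm))
    have h2' : e x ≠ v := fun h => h2 (he (h.trans hl.symm))
    simp [sc, h1', h2']

theorem Adj.ne {p : K} {u v : Fin n} (h : Adj q u v p) : u ≠ v := by
  rintro rfl
  rcases h with ⟨h, _⟩ | ⟨h, _⟩ <;> omega

theorem Adj.p_ne (hq : q ≠ 0) {p : K} {u v : Fin n} (h : Adj q u v p) : p ≠ 0 := by
  rcases h with ⟨_, rfl⟩ | ⟨_, rfl⟩
  · exact hq
  · exact inv_ne_zero hq

theorem rowHom_minor (hq : q ≠ 0) {p : K} {u v : Fin m} (h : Adj q u v p)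
    {φ : QMat K q m n →ₐ[K] Matrix (Fin 2) (Fin 2) (QMat K q m n)}
    (hφ : ∀ i j, φ (X K q i j) = rowF q p u v i j) (e : Fin m → Fin n) :
    φ (minor q e) = tri (minor q e) 0 (minor q e) := by
  have huv := h.ne
  have hp := h.p_ne hq
  -- the off-diagonal entry
  have hpre : ∀ σ : Equiv.Perm (Fin m),
      (∏ k, if k < σ⁻¹ u then sc p u v (σ k) else 1) = if σ⁻¹ v < σ⁻¹ u then p⁻¹ else 1 := by
    intro σ
    rw [Fintype.prod_eq_single (σ⁻¹ v)]
    · simp [sc, huv.symm]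
    · intro k hk
      split_ifs with h1
      · have a1 : σ k ≠ u := by
          rintro rfl
          simp at h1
        have a2 : σ k ≠ v := by
          rintro rfl
          simp at hk
        simp [sc, a1, a2]
      · rfl
  have hoff : ∑ σ : Equiv.Perm (Fin m), ((-q) ^ invCount σ) •
      ((∏ k, if k < σ⁻¹ u then sc p u v (σ k) else 1) •
      (List.ofFn (Function.update (fun k => X K q (σ k) (e k)) (σ⁻¹ u)
        (X K q v (e (σ⁻¹ u))))).prod) = 0 := by
    simp only [hpre]
    have main : ∀ σ : Equiv.Perm (Fin m), σ⁻¹ u < σ⁻¹ v →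
        ((-q) ^ invCount σ) • ((if σ⁻¹ v < σ⁻¹ u then p⁻¹ else (1 : K)) •
          (List.ofFn (Function.update (fun k => X K q (σ k) (e k)) (σ⁻¹ u)
            (X K q v (e (σ⁻¹ u))))).prod) +
        ((-q) ^ invCount (Equiv.swap u v * σ)) •
          ((if (Equiv.swap u v * σ)⁻¹ v < (Equiv.swap u v * σ)⁻¹ u then p⁻¹ else (1 : K)) •
          (List.ofFn (Function.update (fun k => X K q ((Equiv.swap u v * σ) k) (e k))
            ((Equiv.swap u v * σ)⁻¹ u)
            (X K q v (e ((Equiv.swap u v * σ)⁻¹ u))))).prod) = 0 := by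
      intro σ hσ
      have e1 : (Equiv.swap u v * σ)⁻¹ u = σ⁻¹ v := by simp [mul_inv_rev]
      have e2 : (Equiv.swap u v * σ)⁻¹ v = σ⁻¹ u := by simp [mul_inv_rev]
      rw [e1, e2]
      have e3 : (Function.update (fun k => X K q ((Equiv.swap u v * σ) k) (e k))
          (σ⁻¹ v) (X K q v (e (σ⁻¹ v)))) =
          (Function.update (fun k => X K q (σ k) (e k)) (σ⁻¹ u) (X K q v (e (σ⁻¹ u)))) := by
        funext k
        by_cases hku : k = σ⁻¹ u
        · subst hku
          rw [Function.update_of_ne hσ.ne]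
          simp
        · rw [Function.update_of_ne hku]
          by_cases hkv : k = σ⁻¹ v
          · subst hkv
            simp
          · rw [Function.update_of_ne hkv]
            have a1 : σ k ≠ u := by
              rintro rfl
              simp at hku
            have a2 : σ k ≠ v := by
              rintro rfl
              simp at hkv
            simp [Equiv.swap_apply_of_ne_of_ne a1 a2]
      rw [e3, if_neg hσ.not_gt, if_pos hσ]
      rcases h with ⟨hv, rfl⟩ | ⟨hv, rfl⟩
      · rw [invCount_swap_mul σ hv hσ, pow_succ]
        match_scalars
        field_simp
        ring
      · have := invCount_swap_mul (Equiv.swap u v * σ) hv (by rw [e1, e2]; exact hσ)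
        rw [Equiv.swap_comm v u, ← mul_assoc, Equiv.swap_mul_self, one_mul] at this
        rw [this, pow_succ]
        match_scalars
        field_simp
        ring
    refine Finset.sum_involution (fun σ _ => Equiv.swap u v * σ) ?_ ?_ ?_ ?_
    · intro σ _
      rcases lt_or_gt_of_ne (fun h => huv (σ⁻¹.injective h) : σ⁻¹ u ≠ σ⁻¹ v) with h | h
      · exact main σ h
      · have := main (Equiv.swap u v * σ) (by simpa [mul_inv_rev] using h)
        rw [← mul_assoc, Equiv.swap_mul_self, one_mul, add_comm] at this
        exact this
    · intro σ _ _ h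
      have := congrArg (fun τ : Equiv.Perm (Fin m) => τ (σ⁻¹ u)) h
      simp at this
      exact huv this.symm
    · intros; simp
    · intros; simp [← mul_assoc]
  have hone : ∀ σ : Equiv.Perm (Fin m), ∏ k, sc p u v (σ k) = 1 := fun σ =>
    prod_sc hp huv σ (k := σ⁻¹ u) (l := σ⁻¹ v) (by simp) (by simp) σ.injective
  rw [← hoff]
  unfold minor qMinor
  simp only [map_sum, map_smul, map_list_prod, List.map_ofFn, Function.comp_def, hφ, rowF]
  rw [← tri_sum]
  refine Finset.sum_congr rfl fun σ _ => ?_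
  rw [prod_tri (fun k => sc p u v (σ k)) (fun k => X K q (σ k) (e k))
    (fun k => if σ k = u then X K q v (e k) else 0) (σ⁻¹ u)
      (fun k hk => if_neg (by rintro rfl; simp at hk)), tri_smul, hone, one_smul]
  simp

/-- `X_{ij}` and the minor quasi-commute with constant `c`. -/
def QX (q : K) (e : Fin m → Fin n) (c : K) (i : Fin m) (j : Fin n) : Prop :=
  X K q i j * minor q e = c • (minor q e * X K q i j)

theorem QX_row_step (hq : q ≠ 0) {p : K} {u v : Fin m} (h : Adj q u v p) {e : Fin m → Fin n}
    {c : K} {j : Fin n} (H : QX q e c u j) : QX q e c v j := by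
  obtain ⟨φ, hφ⟩ := exists_rowHom (n := n) hq h
  have := congrArg φ H
  rw [map_smul, map_mul, map_mul, rowHom_minor hq h hφ, hφ, rowF, tri_mul, tri_mul,
    tri_smul] at this
  have := congrFun (congrFun this 0) 1
  simpa [tri, QX] using this

theorem QX_row (hq : q ≠ 0) {e : Fin m → Fin n} {c : K} {j : Fin n} {i0 : Fin m}
    (H : QX q e c i0 j) (i : Fin m) : QX q e c i j := by
  have hm : 0 < m := i.pos
  have key : ∀ k (hk : k < m), QX q e c ⟨k, hk⟩ j ↔ QX q e c ⟨0, hm⟩ j := by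
    intro k
    induction k with
    | zero => intro _; rfl
    | succ k ih =>
      intro hk
      rw [← ih (by omega)]
      exact ⟨QX_row_step hq (Or.inr ⟨rfl, rfl⟩), QX_row_step hq (Or.inl ⟨rfl, rfl⟩)⟩
  exact (key i.1 i.2).2 ((key i0.1 i0.2).1 H)

/-- The column skew derivation kills a minor containing both columns. -/
theorem colHom_minor_both (hq : q ≠ 0) {p : K} {u v : Fin n} (h : Adj q u v p)
    {φ : QMat K q m n →ₐ[K] Matrix (Fin 2) (Fin 2) (QMat K q m n)}
    (hφ : ∀ i j, φ (X K q i j) = colF q p u v i j) {e : Fin m → Fin n} (he : StrictMono e)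
    {k l : Fin m} (hk : e k = u) (hl : e l = v) :
    φ (minor q e) = tri (minor q e) 0 (minor q e) := by
  rw [colHom_minor hφ e k hk (fun k' hk' h' => hk' (he.injective (h'.trans hk.symm))),
    prod_sc (h.p_ne hq) h.ne e hk hl he.injective, one_smul]
  have hkl : k ≠ l := by
    rintro rfl
    exact h.ne (hk.symm.trans hl)
  have hz : minor q (Function.update e k v) = 0 := by
    rcases h with ⟨h1, _⟩ | ⟨h1, _⟩
    · refine minor_eq_zero (k := k) (l := l) _ ?_ (by simp [Function.update_of_ne hkl.symm, hl])
      have h2 : k < l := he.lt_iff_lt.1 (by rw [hk, hl, Fin.lt_def]; omega)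
      by_contra h3
      have h4 : k.val + 1 < l.val := by rw [Fin.lt_def] at h2; omega
      have h5 : k.val + 1 < m := by have := l.2; omega
      have h6 : e k < e ⟨k.val + 1, h5⟩ := he (by rw [Fin.lt_def]; simp)
      have h7 : e ⟨k.val + 1, h5⟩ < e l := he (by rw [Fin.lt_def]; simpa using h4)
      rw [hk] at h6
      rw [hl] at h7
      rw [Fin.lt_def] at h6 h7
      omega
    · refine minor_eq_zero (k := l) (l := k) _ ?_ (by simp [Function.update_of_ne hkl.symm, hl])
      have h2 : l < k := he.lt_iff_lt.1 (by rw [hk, hl, Fin.lt_def]; omega)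
      by_contra h3
      have h4 : l.val + 1 < k.val := by rw [Fin.lt_def] at h2; omega
      have h5 : l.val + 1 < m := by have := k.2; omega
      have h6 : e l < e ⟨l.val + 1, h5⟩ := he (by rw [Fin.lt_def]; simp)
      have h7 : e ⟨l.val + 1, h5⟩ < e k := he (by rw [Fin.lt_def]; simpa using h4)
      rw [hl] at h6
      rw [hk] at h7
      rw [Fin.lt_def] at h6 h7
      omega
  rw [hz, smul_zero]

theorem QX_col_step (hq : q ≠ 0) {p : K} {u v : Fin n} (h : Adj q u v p) {e : Fin m → Fin n}
    (he : StrictMono e) {k l : Fin m} (hk : e k = u) (hl : e l = v)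
    {c : K} {i : Fin m} (H : QX q e c i u) : QX q e c i v := by
  obtain ⟨φ, hφ⟩ := exists_colHom (m := m) hq h
  have := congrArg φ H
  rw [map_smul, map_mul, map_mul, colHom_minor_both hq h hφ he hk hl, hφ, colF, tri_mul, tri_mul,
    tri_smul] at this
  have := congrFun (congrFun this 0) 1
  simpa [tri, QX] using this

/-- Moving a column of the second minor inside the first one. -/
theorem minor_move (hq : q ≠ 0) {p : K} {u v : Fin n} (h : Adj q u v p) {e f : Fin m → Fin n}
    (he : StrictMono e) (hf : StrictMono f) {k l k0 : Fin m} (hk : e k = u) (hl : e l = v)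
    (hk0 : f k0 = u) (hv : ∀ k, f k ≠ v) {c : K}
    (H : minor q e * minor q f = c • (minor q f * minor q e)) :
    minor q e * minor q (Function.update f k0 v) =
      c • (minor q (Function.update f k0 v) * minor q e) := by
  obtain ⟨φ, hφ⟩ := exists_colHom (m := m) hq h
  have h1 : ∀ k, k ≠ k0 → f k ≠ u := fun k' hk' h' => hk' (hf.injective (h'.trans hk0.symm))
  have := congrArg φ H
  have hp : (∏ k, if k < k0 then sc p u v (f k) else 1) = 1 := by
    refine Finset.prod_eq_one fun k _ => ?_
    split_ifs with hkk
    · simp [sc, h1 k hkk.ne, hv k]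
    · rfl
  rw [map_smul, map_mul, map_mul, colHom_minor_both hq h hφ he hk hl,
    colHom_minor hφ f k0 hk0 h1, hp, tri_mul, tri_mul, tri_smul] at this
  have := congrFun (congrFun this 0) 1
  simpa [tri] using this

theorem QX_last (hq : q ≠ 0) {e : Fin m → Fin n} {j : Fin n} (hj : ∀ k, j ≤ e k)
    {i : Fin m} (hi : i.val + 1 = m) :
    QX q e (q * ∏ k, if e k = j then q⁻¹ else 1) i j := by
  unfold QX minor qMinor
  rw [Finset.mul_sum, Finset.sum_mul, Finset.smul_sum]
  refine Finset.sum_congr rfl fun σ _ => ?_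
  rw [mul_smul_comm, smul_mul_assoc, smul_comm, ofFn_qcomm _ _
    (fun k => (if σ k = i then q else 1) * (if e k = j then q⁻¹ else 1))]
  · rw [Finset.prod_mul_distrib]
    congr 3
    rw [Equiv.prod_comp σ (fun k => if k = i then q else 1)]
    simp
  · intro k
    beta_reduce
    have hle : σ k ≤ i := by have := (σ k).2; rw [Fin.le_def]; omega
    rcases hle.eq_or_lt with h1 | h1 <;> rcases (hj k).eq_or_lt with h2 | h2
    · simp [h1, ← h2, hq]
    · simp [h1, h2.ne', X_row i h2]
    · rw [← h2, X_col j h1]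
      simp [h1.ne, hq]
    · simp [h1.ne, h2.ne', X_comm h1 h2]

theorem QX_first (hq : q ≠ 0) {e : Fin m → Fin n} {j : Fin n} (hj : ∀ k, e k ≤ j)
    {i : Fin m} (hi : i.val = 0) :
    QX q e (q⁻¹ * ∏ k, if e k = j then q else 1) i j := by
  unfold QX minor qMinor
  rw [Finset.mul_sum, Finset.sum_mul, Finset.smul_sum]
  refine Finset.sum_congr rfl fun σ _ => ?_
  rw [mul_smul_comm, smul_mul_assoc, smul_comm, ofFn_qcomm _ _
    (fun k => (if σ k = i then q⁻¹ else 1) * (if e k = j then q else 1))]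
  · rw [Finset.prod_mul_distrib]
    congr 3
    rw [Equiv.prod_comp σ (fun k => if k = i then q⁻¹ else 1)]
    simp
  · intro k
    beta_reduce
    have hle : i ≤ σ k := by rw [Fin.le_def]; omega
    rcases hle.eq_or_lt with h1 | h1 <;> rcases (hj k).eq_or_lt with h2 | h2
    · simp [← h1, h2, hq]
    · rw [← h1, X_row i h2]
      simp [h2.ne, hq]
    · rw [h2, X_col j h1]
      simp [h1.ne']
    · simp [h1.ne', h2.ne, X_comm h1 h2]

/-- Column `j` quasi-commutes with the minor, uniformly in the row. -/
def QJ (q : K) (e : Fin m → Fin n) (j : Fin n) : Prop :=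
  ∃ c : ℤ, ∀ i, QX q e (q ^ c) i j

theorem exists_zpow_prod (hq : q ≠ 0) {ι : Type*} (s : Finset ι) (f : ι → K)
    (h : ∀ k ∈ s, ∃ c : ℤ, f k = q ^ c) : ∃ c : ℤ, ∏ k ∈ s, f k = q ^ c := by
  refine Finset.prod_induction f (fun x => ∃ c : ℤ, x = q ^ c) ?_ ⟨0, by simp⟩ h
  rintro a b ⟨c, rfl⟩ ⟨d, rfl⟩
  exact ⟨c + d, by rw [zpow_add₀ hq]⟩

theorem QJ_le (hq : q ≠ 0) (hm : 0 < m) {e : Fin m → Fin n} {j : Fin n} (hj : ∀ k, j ≤ e k) :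
    QJ q e j := by
  obtain ⟨c, hc⟩ := exists_zpow_prod hq Finset.univ (fun k => if e k = j then q⁻¹ else 1)
    (fun k _ => by
      split_ifs
      · exact ⟨-1, by simp⟩
      · exact ⟨0, by simp⟩)
  refine ⟨1 + c, fun i => QX_row hq (i0 := ⟨m - 1, by omega⟩) ?_ i⟩
  rw [zpow_add₀ hq, zpow_one, ← hc]
  exact QX_last hq hj (by simp; omega)

theorem QJ_ge (hq : q ≠ 0) (hm : 0 < m) {e : Fin m → Fin n} {j : Fin n} (hj : ∀ k, e k ≤ j) :
    QJ q e j := by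
  obtain ⟨c, hc⟩ := exists_zpow_prod hq Finset.univ (fun k => if e k = j then q else 1)
    (fun k _ => by
      split_ifs
      · exact ⟨1, by simp⟩
      · exact ⟨0, by simp⟩)
  refine ⟨-1 + c, fun i => QX_row hq (i0 := ⟨0, hm⟩) ?_ i⟩
  rw [zpow_add₀ hq, zpow_neg_one, ← hc]
  exact QX_first hq hj rfl

theorem QJ_up (hq : q ≠ 0) {e : Fin m → Fin n} (he : StrictMono e) {a : Fin n}
    (ha : QJ q e a) : ∀ (d : ℕ) (j : Fin n), j.val = a.val + d →
    (∀ x, a ≤ x → x ≤ j → ∃ k, e k = x) → QJ q e j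
  | 0, j, hj, h => by
    have : j = a := Fin.ext (by simpa using hj)
    rwa [this]
  | d + 1, j, hj, h => by
    have hlt : a.val + d < n := by have := j.2; omega
    obtain ⟨c, hc⟩ := QJ_up hq he ha d ⟨a.val + d, hlt⟩ rfl
      (fun x h1 h2 => h x h1 (by rw [Fin.le_def] at *; simp at h2; omega))
    obtain ⟨k, hk⟩ := h ⟨a.val + d, hlt⟩ (by rw [Fin.le_def]; simp)
      (by rw [Fin.le_def]; simp; omega)
    obtain ⟨l, hl⟩ := h j (by rw [Fin.le_def]; omega) le_rfl
    exact ⟨c, fun i => QX_col_step hq (Or.inl ⟨by simp; omega, rfl⟩) he hk hl (hc i)⟩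

theorem QJ_down (hq : q ≠ 0) {e : Fin m → Fin n} (he : StrictMono e) {a : Fin n}
    (ha : QJ q e a) : ∀ (d : ℕ) (j : Fin n), j.val + d = a.val →
    (∀ x, j ≤ x → x ≤ a → ∃ k, e k = x) → QJ q e j
  | 0, j, hj, h => by
    have : j = a := Fin.ext (by simpa using hj)
    rwa [this]
  | d + 1, j, hj, h => by
    have hlt : j.val + 1 < n := by have := a.2; omega
    obtain ⟨c, hc⟩ := QJ_down hq he ha d ⟨j.val + 1, hlt⟩ (by simp; omega)
      (fun x h1 h2 => h x (by rw [Fin.le_def] at *; simp at h1; omega) h2)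
    obtain ⟨k, hk⟩ := h ⟨j.val + 1, hlt⟩ (by rw [Fin.le_def]; simp)
      (by rw [Fin.le_def]; simp; omega)
    obtain ⟨l, hl⟩ := h j le_rfl (by rw [Fin.le_def]; omega)
    exact ⟨c, fun i => QX_col_step hq (Or.inr ⟨by simp, rfl⟩) he hk hl (hc i)⟩

/-- Two elements quasi-commute. -/
def QC (q : K) (a b : QMat K q m n) : Prop := ∃ c : ℤ, a * b = q ^ c • (b * a)

theorem QC.symm (hq : q ≠ 0) {a b : QMat K q m n} (h : QC q a b) : QC q b a := by
  obtain ⟨c, hc⟩ := h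
  refine ⟨-c, ?_⟩
  rw [hc, smul_smul, ← zpow_add₀ hq]
  simp

theorem minor_qc (hq : q ≠ 0) {e f : Fin m → Fin n} (h : ∀ k, QJ q e (f k)) :
    QC q (minor q e) (minor q f) := by
  choose c hc using h
  obtain ⟨d, hd⟩ := exists_zpow_prod hq Finset.univ (fun k => q ^ (- c k)) (fun k _ => ⟨_, rfl⟩)
  refine ⟨d, ?_⟩
  rw [← hd]
  conv_lhs => rw [minor.eq_def q f]
  conv_rhs => rw [minor.eq_def q f]
  unfold qMinor
  rw [Finset.mul_sum, Finset.sum_mul, Finset.smul_sum]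
  refine Finset.sum_congr rfl fun σ _ => ?_
  rw [mul_smul_comm, smul_mul_assoc, smul_comm, ofFn_qcomm _ _ (fun k => q ^ (- c k))]
  intro k
  have := hc k (σ k)
  unfold QX at this
  rw [this, smul_smul, ← zpow_add₀ hq]
  simp

theorem grMinor_eq {J : Finset (Fin n)} (h : J.card = m) :
    grMinor K q m J = minor q (J.orderEmbOfFin h) := by
  simp [grMinor, h, minor]

theorem mem_emb {J : Finset (Fin n)} (h : J.card = m) (x : Fin n) :
    (∃ k, J.orderEmbOfFin h k = x) ↔ x ∈ J := by
  have := Finset.range_orderEmbOfFin J h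
  rw [← Finset.mem_coe, ← this, Set.mem_range]

theorem grMinor_move (hq : q ≠ 0) {p : K} {u v : Fin n} (h : Adj q u v p)
    {M J : Finset (Fin n)} (hM : M.card = m) (hJ : J.card = m) (uM : u ∈ M) (vM : v ∈ M)
    (uJ : u ∈ J) (vJ : v ∉ J) (H : QC q (grMinor K q m M) (grMinor K q m J)) :
    QC q (grMinor K q m M) (grMinor K q m (insert v (J.erase u))) := by
  have hJ' : (insert v (J.erase u)).card = m := by
    rw [Finset.card_insert_of_notMem (fun h => vJ (Finset.mem_of_mem_erase h)),
      Finset.card_erase_add_one uJ, hJ]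
  obtain ⟨k, hk⟩ := (mem_emb hM u).2 uM
  obtain ⟨l, hl⟩ := (mem_emb hM v).2 vM
  obtain ⟨k0, hk0⟩ := (mem_emb hJ u).2 uJ
  have hv : ∀ k, J.orderEmbOfFin hJ k ≠ v := by
    intro k hk
    exact vJ ((mem_emb hJ v).1 ⟨k, hk⟩)
  rw [grMinor_eq hM, grMinor_eq hJ] at H
  rw [grMinor_eq hM, grMinor_eq hJ']
  obtain ⟨c, hc⟩ := H
  have := minor_move hq h (M.orderEmbOfFin hM).strictMono (J.orderEmbOfFin hJ).strictMono
    hk hl hk0 hv hc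
  have e1 : Function.update (J.orderEmbOfFin hJ) k0 v = (insert v (J.erase u)).orderEmbOfFin hJ' := by
    apply Finset.orderEmbOfFin_unique
    · intro x
      by_cases hx : x = k0
      · subst hx; simp
      · rw [Function.update_of_ne hx]
        refine Finset.mem_insert_of_mem (Finset.mem_erase.2 ⟨?_, Finset.orderEmbOfFin_mem _ _ _⟩)
        rw [← hk0]
        exact fun h => hx ((J.orderEmbOfFin hJ).injective h)
    · intro a b hab
      have hlt := (J.orderEmbOfFin hJ).strictMono hab
      have va := hv a
      have vb := hv b
      rw [Ne, Fin.ext_iff] at va vb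
      by_cases ha : a = k0
      · subst ha
        rw [Function.update_self, Function.update_of_ne hab.ne']
        rw [hk0] at hlt
        rw [Fin.lt_def] at *
        rcases h with ⟨h, _⟩ | ⟨h, _⟩ <;> omega
      · by_cases hb : b = k0
        · subst hb
          rw [Function.update_self, Function.update_of_ne hab.ne]
          rw [hk0] at hlt
          rw [Fin.lt_def] at *
          rcases h with ⟨h, _⟩ | ⟨h, _⟩ <;> omega
        · rwa [Function.update_of_ne ha, Function.update_of_ne hb]
  rw [e1] at this
  exact ⟨c, this⟩

theorem QJ_left (hq : q ≠ 0) (hm : 0 < m) {J : Finset (Fin n)} (hJ : J.card = m) (j : Fin n)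
    (h : ∀ x ∈ J, ∀ y, x ≤ y → y ≤ j → y ∈ J) : QJ q (J.orderEmbOfFin hJ) j := by
  have hne : J.Nonempty := Finset.card_pos.1 (by omega)
  have hmin : QJ q (J.orderEmbOfFin hJ) (J.min' hne) := QJ_le hq hm
    (fun k => J.min'_le _ (Finset.orderEmbOfFin_mem _ _ _))
  rcases le_total j (J.min' hne) with h1 | h1
  · exact QJ_le hq hm (fun k => h1.trans (J.min'_le _ (Finset.orderEmbOfFin_mem _ _ _)))
  · refine QJ_up hq (J.orderEmbOfFin hJ).strictMono hmin (j.val - (J.min' hne).val) j ?_ ?_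
    · rw [Fin.le_def] at h1; omega
    · intro x hx1 hx2
      exact (mem_emb hJ x).2 (h _ (J.min'_mem hne) x hx1 hx2)

theorem QJ_right (hq : q ≠ 0) (hm : 0 < m) {J : Finset (Fin n)} (hJ : J.card = m) (j : Fin n)
    (h : ∀ x ∈ J, ∀ y, j ≤ y → y ≤ x → y ∈ J) : QJ q (J.orderEmbOfFin hJ) j := by
  have hne : J.Nonempty := Finset.card_pos.1 (by omega)
  have hmax : QJ q (J.orderEmbOfFin hJ) (J.max' hne) := QJ_ge hq hm
    (fun k => J.le_max' _ (Finset.orderEmbOfFin_mem _ _ _))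
  rcases le_total (J.max' hne) j with h1 | h1
  · exact QJ_ge hq hm (fun k => (J.le_max' _ (Finset.orderEmbOfFin_mem _ _ _)).trans h1)
  · refine QJ_down hq (J.orderEmbOfFin hJ).strictMono hmax ((J.max' hne).val - j.val) j ?_ ?_
    · rw [Fin.le_def] at h1; omega
    · intro x hx1 hx2
      exact (mem_emb hJ x).2 (h _ (J.max'_mem hne) x hx1 hx2)

/-- The case of an interval. -/
theorem qc_interval (hq : q ≠ 0) (hm : 0 < m) {M J : Finset (Fin n)} (hM : M.card = m)
    (hJ : J.card = m) (a b : ℕ) (hab : ∀ x : Fin n, x ∈ M ↔ a ≤ x.val ∧ x.val < b) :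
    QC q (grMinor K q m M) (grMinor K q m J) := by
  rw [grMinor_eq hM, grMinor_eq hJ]
  apply minor_qc hq
  intro k
  generalize J.orderEmbOfFin hJ k = j
  rcases lt_or_ge j.val b with h | h
  · refine QJ_left hq hm hM j fun x hx y h1 h2 => ?_
    rw [hab] at *
    rw [Fin.le_def] at *
    omega
  · refine QJ_right hq hm hM j fun x hx y h1 h2 => ?_
    rw [hab] at *
    rw [Fin.le_def] at *
    omega

theorem qc_wrap (hq : q ≠ 0) (hm : 0 < m) {M : Finset (Fin n)} (hM : M.card = m)
    (s t : ℕ) (hst : s ≤ t) (hMst : ∀ x : Fin n, x ∈ M ↔ x.val < s ∨ t ≤ x.val) :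
    ∀ (N : ℕ) (J : Finset (Fin n)), J.card = m →
      ∑ j ∈ J, (if j.val < s then s - j.val else j.val) = N →
      QC q (grMinor K q m M) (grMinor K q m J) := by
  intro N
  induction N using Nat.strong_induction_on with
  | _ N ih =>
  intro J hJ hN
  -- a single inverse move
  have step : ∀ u v : Fin n, ∀ p : K, Adj q u v p → u ∈ M → v ∈ M → v ∈ J → u ∉ J →
      (if u.val < s then s - u.val else u.val) < (if v.val < s then s - v.val else v.val) →
      QC q (grMinor K q m M) (grMinor K q m J) := by
    intro u v p huv uM vM vJ uJ hlt
    have hu : u ∉ J.erase v := fun h => uJ (Finset.mem_of_mem_erase h)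
    have hc : (insert u (J.erase v)).card = m := by
      rw [Finset.card_insert_of_notMem hu, Finset.card_erase_add_one vJ, hJ]
    have h1 := ih _ (by
      rw [← hN, Finset.sum_insert hu, ← Finset.add_sum_erase J _ vJ]
      exact Nat.add_lt_add_right hlt _) (insert u (J.erase v)) hc rfl
    have h2 := grMinor_move hq huv hM hc uM vM (Finset.mem_insert_self _ _)
      (by simp [huv.ne.symm]) h1
    rwa [Finset.erase_insert hu, Finset.insert_erase vJ] at h2
  by_cases hL : ∃ u v : Fin n, u.val = v.val + 1 ∧ u.val < s ∧ v ∈ J ∧ u ∉ J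
  · obtain ⟨u, v, h1, h2, h3, h4⟩ := hL
    refine step u v q⁻¹ (Or.inr ⟨h1, rfl⟩) ((hMst _).2 (by omega)) ((hMst _).2 (by omega)) h3 h4 ?_
    split_ifs <;> omega
  by_cases hR : ∃ u v : Fin n, v.val = u.val + 1 ∧ t ≤ u.val ∧ v ∈ J ∧ u ∉ J
  · obtain ⟨u, v, h1, h2, h3, h4⟩ := hR
    refine step u v q (Or.inl ⟨h1, rfl⟩) ((hMst _).2 (by omega)) ((hMst _).2 (by omega)) h3 h4 ?_
    split_ifs <;> omega
  push Not at hL hR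
  have cL : ∀ (d : ℕ) (x y : Fin n), x ∈ J → y.val = x.val + d → y.val < s → y ∈ J := by
    intro d
    induction d with
    | zero =>
      intro x y hx hy _
      rwa [show y = x from Fin.ext (by simpa using hy)]
    | succ d ih' =>
      intro x y hx hy hs
      have hlt : x.val + d < n := by have := y.2; omega
      exact hL y ⟨x.val + d, hlt⟩ (by simp; omega) hs (ih' x _ hx rfl (by simp; omega))
  have cR : ∀ (d : ℕ) (x y : Fin n), x ∈ J → y.val + d = x.val → t ≤ y.val → y ∈ J := by
    intro d
    induction d with
    | zero =>
      intro x y hx hy _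
      rwa [show y = x from Fin.ext (by simpa using hy)]
    | succ d ih' =>
      intro x y hx hy hs
      have hlt : y.val + 1 < n := by have := x.2; omega
      exact hR y ⟨y.val + 1, hlt⟩ (by simp) hs (ih' x _ hx (by simp; omega) (by simp; omega))
  refine QC.symm hq ?_
  rw [grMinor_eq hM, grMinor_eq hJ]
  apply minor_qc hq
  intro k
  have hj := (hMst _).1 (Finset.orderEmbOfFin_mem M hM k)
  generalize M.orderEmbOfFin hM k = j at hj
  rcases hj with h | h
  · refine QJ_left hq hm hJ j fun x hx y h1 h2 => ?_
    rw [Fin.le_def] at h1 h2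
    exact cL (y.val - x.val) x y hx (by omega) (by omega)
  · refine QJ_right hq hm hJ j fun x hx y h1 h2 => ?_
    rw [Fin.le_def] at h1 h2
    exact cR (x.val - y.val) x y hx (by omega) (by omega)

theorem add_mod_formula {n m : ℕ} (hn : 0 < n) (hmn : m < n) (α k : ℕ) (hk : k < m) :
    (α + k) % n = if α % n + k < n then α % n + k else α % n + k - n := by
  have h0 := Nat.mod_lt α hn
  rw [Nat.add_mod, Nat.mod_eq_of_lt (show k < n by omega)]
  split_ifs with h
  · exact Nat.mod_eq_of_lt h
  · rw [Nat.mod_eq_sub_mod (by omega), Nat.mod_eq_of_lt (by omega)]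

theorem card_consecSet {n m : ℕ} (hn : 0 < n) (hmn : m < n) (α : ℕ) :
    (consecSet hn m α).card = m := by
  unfold consecSet
  rw [Finset.card_image_of_injOn, Finset.card_range]
  intro a ha b hb hab
  have ha' : a < m := by simpa using ha
  have hb' : b < m := by simpa using hb
  have h : (α + a) % n = (α + b) % n := congrArg Fin.val hab
  rw [add_mod_formula hn hmn α a ha', add_mod_formula hn hmn α b hb'] at h
  have h0 := Nat.mod_lt α hn
  split_ifs at h <;> omega

theorem mem_consecSet {n m : ℕ} (hn : 0 < n) (hmn : m < n) (α : ℕ) (x : Fin n) :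
    x ∈ consecSet hn m α ↔
      ∃ k < m, x.val = if α % n + k < n then α % n + k else α % n + k - n := by
  simp only [consecSet, Finset.mem_image, Finset.mem_range, fmod, Fin.ext_iff]
  refine exists_congr fun k => and_congr_right fun hk => ?_
  rw [add_mod_formula hn hmn α k hk, eq_comm]

theorem qc_consec (hq : q ≠ 0) (hm : 0 < m) (hmn : m < n) (hn : 0 < n) (α : ℕ)
    {J : Finset (Fin n)} (hJ : J.card = m) :
    QC q (grMinor K q m (consecSet hn m α)) (grMinor K q m J) := by
  have h0 := Nat.mod_lt α hn
  rcases Nat.lt_or_ge n (α % n + m) with h | h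
  · refine qc_wrap hq hm (card_consecSet hn hmn α) (α % n + m - n) (α % n) (by omega)
      (fun x => ?_) _ J hJ rfl
    rw [mem_consecSet hn hmn]
    have := x.2
    constructor
    · rintro ⟨k, hk, hx⟩
      split_ifs at hx <;> omega
    · rintro (h1 | h1)
      · exact ⟨x.val + n - α % n, by omega, by split_ifs <;> omega⟩
      · exact ⟨x.val - α % n, by omega, by split_ifs <;> omega⟩
  · refine qc_interval hq hm (card_consecSet hn hmn α) hJ (α % n) (α % n + m) (fun x => ?_)
    rw [mem_consecSet hn hmn]
    have := x.2
    constructor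
    · rintro ⟨k, hk, hx⟩
      split_ifs at hx <;> omega
    · rintro ⟨h1, h2⟩
      exact ⟨x.val - α % n, by omega, by split_ifs <;> omega⟩

/-- Quasi-commuting with the generators implies normality. -/
theorem normal_of_qc (hq : q ≠ 0) (u : QMat K q m n)
    (h : ∀ J : Finset (Fin n), J.card = m → QC q u (grMinor K q m J)) :
    (∀ a ∈ qGrass K q m n, ∃ b ∈ qGrass K q m n, u * a = b * u) ∧
    (∀ a ∈ qGrass K q m n, ∃ b ∈ qGrass K q m n, a * u = u * b) := by
  have hmem : ∀ J : Finset (Fin n), grMinor K q m J ∈ qGrass K q m n := fun J =>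
    Algebra.subset_adjoin ⟨J, rfl⟩
  constructor
  · intro a ha
    induction ha using Algebra.adjoin_induction with
    | mem x hx =>
      obtain ⟨J, rfl⟩ := hx
      by_cases hJ : J.card = m
      · obtain ⟨c, hc⟩ := h J hJ
        exact ⟨q ^ c • grMinor K q m J, Subalgebra.smul_mem _ (hmem J) _, by
          rw [hc, smul_mul_assoc]⟩
      · exact ⟨0, zero_mem _, by simp [grMinor, hJ]⟩
    | algebraMap r => exact ⟨_, Subalgebra.algebraMap_mem _ r, (Algebra.commutes r u).symm⟩
    | add x y _ _ hx hy =>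
      obtain ⟨b, hb, e1⟩ := hx
      obtain ⟨b', hb', e2⟩ := hy
      exact ⟨b + b', add_mem hb hb', by rw [mul_add, e1, e2, add_mul]⟩
    | mul x y _ _ hx hy =>
      obtain ⟨b, hb, e1⟩ := hx
      obtain ⟨b', hb', e2⟩ := hy
      exact ⟨b * b', mul_mem hb hb', by rw [← mul_assoc, e1, mul_assoc, e2, mul_assoc]⟩
  · intro a ha
    induction ha using Algebra.adjoin_induction with
    | mem x hx =>
      obtain ⟨J, rfl⟩ := hx
      by_cases hJ : J.card = m
      · obtain ⟨c, hc⟩ := (h J hJ).symm hq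
        exact ⟨q ^ c • grMinor K q m J, Subalgebra.smul_mem _ (hmem J) _, by
          rw [hc, mul_smul_comm]⟩
      · exact ⟨0, zero_mem _, by simp [grMinor, hJ]⟩
    | algebraMap r => exact ⟨_, Subalgebra.algebraMap_mem _ r, Algebra.commutes r u⟩
    | add x y _ _ hx hy =>
      obtain ⟨b, hb, e1⟩ := hx
      obtain ⟨b', hb', e2⟩ := hy
      exact ⟨b + b', add_mem hb hb', by rw [add_mul, e1, e2, mul_add]⟩
    | mul x y _ _ hx hy =>
      obtain ⟨b, hb, e1⟩ := hx
      obtain ⟨b', hb', e2⟩ := hy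
      exact ⟨b * b', mul_mem hb hb', by rw [mul_assoc, e2, ← mul_assoc, e1, mul_assoc]⟩

end Aux

end QG

namespace QG

/-- Every consecutive quantum minor `[α,α+1,…,α+m−1]` (indices modulo
`n`) quasi-commutes with each generating maximal quantum minor `[J]` of the quantum
grassmannian `O_q(G(m,n))`;  in particular it is a normal element of `O_q(G(m,n))`. -/
theorem consecutive_minor_quasicommutes_and_is_normal
    (K : Type*) [Field K] (q : K) (hq : q ≠ 0) (m n : ℕ) (hm : 0 < m) (hmn : m < n)
    (α : ℕ) :
    (∀ J : Finset (Fin n), J.card = m →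
      ∃ c : ℤ,
        grMinor K q m (consecSet (show 0 < n by omega) m α) * grMinor K q m J =
          q ^ c • (grMinor K q m J * grMinor K q m (consecSet (show 0 < n by omega) m α))) ∧
    (∀ a ∈ qGrass K q m n, ∃ b ∈ qGrass K q m n,
      grMinor K q m (consecSet (show 0 < n by omega) m α) * a =
        b * grMinor K q m (consecSet (show 0 < n by omega) m α)) ∧
    (∀ a ∈ qGrass K q m n, ∃ b ∈ qGrass K q m n,
      a * grMinor K q m (consecSet (show 0 < n by omega) m α) =
        grMinor K q m (consecSet (show 0 < n by omega) m α) * b) := by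
  have hqc := fun (J : Finset (Fin n)) (hJ : J.card = m) =>
    qc_consec (K := K) hq hm hmn (show 0 < n by omega) α hJ
  exact ⟨hqc, normal_of_qc hq _ hqc⟩

end QG
end

section
/- (Quantum Muir's law of extensible minors, grassmannian version.) Let I_s, J_s (1≤s≤d) be m-element subsets of {1,…,n} and c_s ∈ K scalars such that Σ_{s=1}^d c_s [I_s][J_s] = 0 holds in O_q(G(m,n)). Suppose P ⊆ {1,…,n} contains the union of all I_s and all J_s, and let P̄ = {1,…,n}∖P. Then Σ_{s=1}^d c_s [I_s ⊔ P̄][J_s ⊔ P̄] = 0 holds in O_q(G(m',n)), where m' = m + |P̄|. -/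
open scoped BigOperators

namespace QG
section Ext
variable {K : Type*} [Field K] {B : Type*} [Ring B] [Algebra K B]
variable {ι : Type*} [LinearOrder ι]

/-- Ordered product over a finite set. -/
def op (g : ι → B) (S : Finset ι) : B := (S.sort.map g).prod

lemma op_empty (g : ι → B) : op g ∅ = 1 := by simp [op]

lemma op_insert (g : ι → B) {a : ι} {S : Finset ι} (h : ∀ x ∈ S, a < x) :
    op g (insert a S) = g a * op g S := by
  unfold op
  rw [Finset.sort_insert (s := S) (r := fun a b => a ≤ b) (fun b hb => (h b hb).le)
    (fun ha => lt_irrefl _ (h a ha))]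
  simp

lemma op_singleton (g : ι → B) (a : ι) : op g {a} = g a := by simp [op]

/-- Elements which generate a quantum exterior algebra. -/
def QExt (q : K) (f : ι → B) : Prop :=
  (∀ i, f i * f i = 0) ∧ ∀ i k, i < k → f k * f i = (-q) • (f i * f k)

/-- Number of inversions between two sets. -/
def iv (S T : Finset ι) : ℕ := ∑ s ∈ S, (T.filter (· < s)).card

lemma QExt.mul_op {q : K} {f : ι → B} (hf : QExt q f) (a : ι) (T : Finset ι) :
    f a * op f T = if a ∈ T then 0 else
      ((-q) ^ (T.filter (· < a)).card) • op f (insert a T) := by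
  induction T using Finset.induction_on_min with
  | empty => simp [op_empty, op_singleton]
  | insert b T hb ih =>
    have hbT : b ∉ T := fun h => lt_irrefl _ (hb b h)
    rcases lt_trichotomy a b with h | h | h
    · have h1 : ∀ x ∈ insert b T, a < x := by
        intro x hx
        rcases Finset.mem_insert.1 hx with rfl | hx
        · exact h
        · exact h.trans (hb x hx)
      have h2 : a ∉ insert b T := fun h => lt_irrefl _ (h1 a h)
      have h3 : (insert b T).filter (· < a) = ∅ := by
        apply Finset.filter_eq_empty_iff.2
        intro x hx; exact (h1 x hx).le.not_gt
      rw [if_neg h2, h3, op_insert f h1]; simp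
    · subst h
      rw [op_insert f hb, ← mul_assoc, hf.1]; simp
    · rw [op_insert f hb, ← mul_assoc, hf.2 b a h, smul_mul_assoc, mul_assoc, ih]
      by_cases haT : a ∈ T
      · simp [haT]
      · have h2 : a ∉ insert b T := by simp [haT, h.ne']
        have h3 : ∀ x ∈ insert a T, b < x := by
          intro x hx
          rcases Finset.mem_insert.1 hx with rfl | hx
          · exact h
          · exact hb x hx
        rw [if_neg haT, if_neg h2, Finset.filter_insert, if_pos h,
          Finset.card_insert_of_notMem (by simp [hbT]), Finset.insert_comm, op_insert f h3,
          mul_smul_comm, smul_smul, pow_succ']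

lemma QExt.op_mul_op {q : K} {f : ι → B} (hf : QExt q f) (S T : Finset ι) :
    op f S * op f T = if Disjoint S T then ((-q) ^ iv S T) • op f (S ∪ T) else 0 := by
  induction S using Finset.induction_on_min with
  | empty => simp [op_empty, iv]
  | insert a S ha ih =>
    have haS : a ∉ S := fun h => lt_irrefl _ (ha a h)
    rw [op_insert f ha, mul_assoc, ih]
    by_cases hST : Disjoint S T
    · rw [if_pos hST, mul_smul_comm, hf.mul_op]
      by_cases haT : a ∈ T
      · rw [if_pos (by simp [haT]), if_neg (by simp [haT]), smul_zero]
      · rw [if_neg (by simp [haT, haS]), if_pos (by simp [haT, hST]), smul_smul, ← pow_add]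
        have : (S ∪ T).filter (· < a) = T.filter (· < a) := by
          ext x
          simp only [Finset.mem_filter, Finset.mem_union]
          constructor
          · rintro ⟨h | h, h'⟩
            · exact absurd h' (ha x h).le.not_gt
            · exact ⟨h, h'⟩
          · tauto
        rw [this, iv, iv, Finset.sum_insert haS, add_comm, Finset.insert_union]
    · rw [if_neg hST, if_neg (by simp [hST]), mul_zero]

/-- commuting ordered products -/
lemma op_commute (f g : ι → B) (S T : Finset ι) (h : ∀ i ∈ S, ∀ j ∈ T, Commute (f i) (g j)) :
    Commute (op f S) (op g T) := by
  unfold op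
  apply Commute.list_prod_left
  intro x hx
  apply Commute.list_prod_right
  intro y hy
  simp only [List.mem_map, Finset.mem_sort] at hx hy
  obtain ⟨i, hi, rfl⟩ := hx
  obtain ⟨j, hj, rfl⟩ := hy
  exact h i hi j hj

/-- `∏ (1 + w_j e_j) = ∑ w_S e_S`. -/
lemma op_one_add (w e : ι → B) (h : ∀ i j, Commute (e i) (w j)) (U : Finset ι) :
    op (fun j => 1 + w j * e j) U = ∑ S ∈ U.powerset, op w S * op e S := by
  induction U using Finset.induction_on_min with
  | empty => simp [op_empty]
  | insert a U ha ih =>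
    have haU : a ∉ U := fun h => lt_irrefl _ (ha a h)
    rw [op_insert _ ha, Finset.sum_powerset_insert haU, ih, add_mul, one_mul, Finset.mul_sum]
    congr 1
    apply Finset.sum_congr rfl
    intro S hS
    have hS' : ∀ x ∈ S, a < x := fun x hx => ha x (Finset.mem_powerset.1 hS hx)
    rw [op_insert _ hS', op_insert _ hS']
    have : Commute (e a) (op w S) := by
      have := op_commute e w {a} S (fun i _ j _ => h i j)
      rwa [op_singleton] at this
    rw [mul_assoc, ← mul_assoc (e a), this.eq, mul_assoc, mul_assoc]

/-- interleaving of ordered products -/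
lemma op_mul (c b : ι → B) (h : ∀ i k, i < k → Commute (c k) (b i)) (U : Finset ι) :
    op c U * op b U = op (fun i => c i * b i) U := by
  induction U using Finset.induction_on_min with
  | empty => simp [op_empty]
  | insert a U ha ih =>
    rw [op_insert _ ha, op_insert _ ha, op_insert _ ha, ← ih]
    have : Commute (op c U) (b a) := by
      have := op_commute c b U {a} (fun i hi j hj => by
        rw [Finset.mem_singleton.1 hj]; exact h _ _ (ha i hi))
      rwa [op_singleton] at this
    rw [mul_assoc, ← mul_assoc (op c U), this.eq]
    simp only [mul_assoc]

/-- `∏ (1 + x_i) = 1 + ∑ x_i` when products of entries vanish. -/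
lemma op_one_add_zero (x : ι → B) (h : ∀ i j, x i * x j = 0) (U : Finset ι) :
    op (fun i => 1 + x i) U = 1 + ∑ i ∈ U, x i := by
  induction U using Finset.induction_on_min with
  | empty => simp [op_empty]
  | insert a U ha ih =>
    have haU : a ∉ U := fun h => lt_irrefl _ (ha a h)
    have h0 : x a * ∑ i ∈ U, x i = 0 := by
      rw [Finset.mul_sum]; exact Finset.sum_eq_zero fun i _ => h a i
    rw [op_insert _ ha, ih, Finset.sum_insert haU, add_mul, mul_add, mul_add, h0]
    simp only [one_mul, mul_one, add_zero]
    abel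

lemma op_map {C : Type*} [Ring C] [Algebra K C] (φ : B →ₐ[K] C) (g : ι → B) (S : Finset ι) :
    φ (op g S) = op (fun i => φ (g i)) S := by
  simp [op, map_list_prod, List.map_map, Function.comp_def]

/-- A concrete quantum exterior family with coefficient functionals. -/
lemma exists_qext (K : Type*) [Field K] (q : K) (ι : Type*) [LinearOrder ι] :
    ∃ e : ι → Module.End K (Finset ι → K), QExt q e ∧
      ∀ T S : Finset ι, (op e S) (Pi.single ∅ 1) T = if T = S then 1 else 0 := by
  let e : ι → Module.End K (Finset ι → K) := fun j =>
    { toFun := fun φ S => if j ∈ S then (-q) ^ (S.filter (· < j)).card * φ (S.erase j) else 0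
      map_add' := by intro φ ψ; ext S; simp only [Pi.add_apply]; split_ifs <;> ring
      map_smul' := by
        intro c φ; ext S; simp only [Pi.smul_apply, smul_eq_mul, RingHom.id_apply]
        split_ifs <;> ring }
  have he : ∀ j φ S, e j φ S =
    if j ∈ S then (-q) ^ (S.filter (· < j)).card * φ (S.erase j) else 0 := fun _ _ _ => rfl
  refine ⟨e, ⟨?_, ?_⟩, ?_⟩
  · intro i; ext1 φ; ext S
    simp [he]
  · intro i k hik
    apply LinearMap.ext; intro φ; ext S
    simp only [Module.End.mul_apply, he, LinearMap.smul_apply, Pi.smul_apply, smul_eq_mul]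
    by_cases hk : k ∈ S <;> by_cases hi : i ∈ S <;> simp [hk, hi, hik.ne, hik.ne']
    have h1 : (S.filter (· < k)).card = ((S.erase i).filter (· < k)).card + 1 := by
      rw [Finset.filter_erase, Finset.card_erase_add_one]; simp [hi, hik]
    have h2 : (S.erase k).filter (· < i) = S.filter (· < i) := by
      rw [Finset.filter_erase, Finset.erase_eq_of_notMem]; simp [hik.le]
    rw [h1, h2, pow_succ, Finset.erase_right_comm]; ring
  · intro T S
    induction S using Finset.induction_on_min generalizing T with
    | empty => simp [op_empty, Pi.single_apply]
    | insert a S ha ih =>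
      have haS : a ∉ S := fun h => lt_irrefl _ (ha a h)
      rw [op_insert _ ha, Module.End.mul_apply, he, ih]
      by_cases haT : a ∈ T
      · by_cases hTS : T = insert a S
        · subst hTS
          have : (insert a S).filter (· < a) = ∅ := by
            apply Finset.filter_eq_empty_iff.2
            intro x hx
            rcases Finset.mem_insert.1 hx with rfl | hx
            · exact lt_irrefl _
            · exact (ha x hx).le.not_gt
          simp [this, haS]
        · rw [if_neg hTS, if_pos haT, if_neg, mul_zero]
          intro h; apply hTS; rw [← h, Finset.insert_erase haT]
      · rw [if_neg haT, if_neg]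
        rintro rfl; simp at haT
end Ext
end QG

namespace QG
set_option linter.unusedVariables false
set_option linter.unusedSimpArgs false
section QM
variable {K : Type*} [Field K] {A : Type*} [Ring A] [Algebra K A]
variable {ι κ μ : Type*} [LinearOrder ι] [LinearOrder κ] [LinearOrder μ]

/-- R-matrix coefficient. -/
noncomputable def al (q : K) {ι : Type*} [LinearOrder ι] (i k : ι) : K :=
  if i < k then q - q⁻¹ else if i = k then q - 1 else 0

/-- A quantum matrix (R-matrix form of the relations). -/
def IsQM (q : K) (x : ι → κ → A) : Prop := ∀ i k j l,
  x k j * x i l + al q i k • (x i j * x k l) = x i l * x k j + al q j l • (x i j * x k l)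

lemma al_lt {q : K} {i k : ι} (h : i < k) : al q i k = q - q⁻¹ := by simp [al, h]
lemma al_gt {q : K} {i k : ι} (h : k < i) : al q i k = 0 := by simp [al, h.le, h.ne', h.not_gt]
lemma al_self {q : K} (i : ι) : al q i i = q - 1 := by simp [al]

lemma IsQM.of_rel {q : K} (hq : q ≠ 0) {x : ι → κ → A}
    (row : ∀ i j l, j < l → x i j * x i l = q • (x i l * x i j))
    (col : ∀ i k j, i < k → x i j * x k j = q • (x k j * x i j))
    (comm : ∀ i k j l, k < i → j < l → x i j * x k l = x k l * x i j)
    (qrel : ∀ i k j l, i < k → j < l →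
      x i j * x k l - x k l * x i j = (q - q⁻¹) • (x i l * x k j)) : IsQM q x := by
  intro i k j l
  rcases lt_trichotomy i k with h | rfl | h <;> rcases lt_trichotomy j l with h' | rfl | h'
  · rw [al_lt h, al_lt h', comm k i j l h h']
  · rw [al_lt h, al_self, col i k j h]
    simp only [smul_smul, sub_smul, sub_mul, mul_sub, inv_mul_cancel₀ hq, one_smul, one_mul]
    abel
  · rw [al_lt h, al_gt h', ← qrel i k l j h h']; simp
  · rw [al_self, al_lt h', row i j l h']
    simp only [smul_smul, sub_smul, sub_mul, mul_sub, inv_mul_cancel₀ hq, one_smul, one_mul]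
    abel
  · rw [al_self, al_self]
  · rw [al_self, al_gt h', row i l j h']
    simp [sub_smul]
  · rw [al_gt h, al_lt h', comm i k j l h h', ← qrel k i j l h h']; simp
  · rw [al_gt h, al_self, col k i j h]
    simp [sub_smul]
  · rw [al_gt h, al_gt h', comm i k l j h h']

lemma IsQM.comm {q : K} {x : ι → κ → A} (hx : IsQM q x) {i k : ι} {j l : κ}
    (h : k < i) (h' : j < l) : x i j * x k l = x k l * x i j := by
  have := hx k i j l
  rw [al_lt h, al_lt h'] at this
  exact add_right_cancel this

lemma IsQM.col {q : K} (hq : q ≠ 0) {x : ι → κ → A} (hx : IsQM q x) {i k : ι} {j : κ}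
    (h : i < k) : x i j * x k j = q • (x k j * x i j) := by
  have := hx k i j j
  rw [al_gt h, al_self, sub_smul, one_smul] at this
  simpa using this

lemma IsQM.row {q : K} (hq : q ≠ 0) {x : ι → κ → A} (hx : IsQM q x) {i : ι} {j l : κ}
    (h : j < l) : x i j * x i l = q • (x i l * x i j) := by
  have := hx i i l j
  rw [al_gt h, al_self, sub_smul, one_smul] at this
  rw [zero_smul, add_zero] at this
  rw [← this]; abel

lemma IsQM.qrel {q : K} {x : ι → κ → A} (hx : IsQM q x) {i k : ι} {j l : κ}
    (h : i < k) (h' : j < l) :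
    x i j * x k l = x k l * x i j + (q - q⁻¹) • (x i l * x k j) := by
  have := hx i k l j
  rw [al_lt h, al_gt h', zero_smul, add_zero] at this
  exact this.symm

lemma IsQM.transpose {q : K} {x : ι → κ → A} (hx : IsQM q x) :
    IsQM q (fun j i => x i j) := by
  intro j l i k
  exact (hx i k j l).symm

lemma IsQM.map {q : K} {x : ι → κ → A} (hx : IsQM q x) {C : Type*} [Ring C] [Algebra K C]
    (φ : A →ₐ[K] C) : IsQM q (fun i j => φ (x i j)) := by
  intro i k j l
  have := congrArg φ (hx i k j l)
  simpa using this

lemma IsQM.mul [Fintype κ] {q : K} {x : ι → κ → A} {y : κ → μ → A} (hx : IsQM q x)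
    (hy : IsQM q y) (hxy : ∀ i p r j, Commute (x i p) (y r j)) :
    IsQM q (fun i j => ∑ p, x i p * y p j) := by
  have key : ∀ i k j l, (∑ p, x i p * y p j) * (∑ r, x k r * y r l) =
      ∑ p, ∑ r, x i p * x k r * (y p j * y r l) := by
    intro i k j l
    rw [Finset.sum_mul_sum]
    refine Finset.sum_congr rfl fun p _ => Finset.sum_congr rfl fun r _ => ?_
    rw [mul_assoc, ← mul_assoc (y p j), ← (hxy k r p j).eq]
    simp only [mul_assoc]
  intro i k j l
  simp only [key]
  calc _ = ∑ p, ∑ r, (x k p * x i r + al q i k • (x i p * x k r)) * (y p j * y r l) := by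
        simp only [Finset.smul_sum, ← Finset.sum_add_distrib, add_mul, smul_mul_assoc]
    _ = ∑ p, ∑ r, (x i r * x k p + al q p r • (x i p * x k r)) * (y p j * y r l) := by
        refine Finset.sum_congr rfl fun p _ => Finset.sum_congr rfl fun r _ => ?_
        rw [hx i k p r]
    _ = ∑ p, ∑ r, x i p * x k r * (y r j * y p l) +
          ∑ p, ∑ r, al q p r • (x i p * x k r * (y p j * y r l)) := by
        rw [Finset.sum_comm (f := fun p r => x i p * x k r * (y r j * y p l))]
        simp only [← Finset.sum_add_distrib, add_mul, smul_mul_assoc]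
    _ = ∑ p, ∑ r, x i p * x k r * (y r j * y p l + al q p r • (y p j * y r l)) := by
        simp only [← Finset.sum_add_distrib, mul_add, mul_smul_comm]
    _ = ∑ p, ∑ r, x i p * x k r * (y p l * y r j + al q j l • (y p j * y r l)) := by
        refine Finset.sum_congr rfl fun p _ => Finset.sum_congr rfl fun r _ => ?_
        rw [hy p r j l]
    _ = _ := by
        simp only [Finset.smul_sum, ← Finset.sum_add_distrib, mul_add, mul_smul_comm]

/-- splitting a double sum -/
lemma sum_sum_lt {M : Type*} [AddCommMonoid M] [Fintype ι] (g : ι → ι → M) :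
    ∑ i, ∑ k, g i k = ∑ i, g i i + ∑ i, ∑ k, if i < k then g i k + g k i else 0 := by
  have h1 : ∀ i k, g i k = (if i = k then g i k else 0) + ((if i < k then g i k else 0) +
      (if k < i then g i k else 0)) := by
    intro i k
    rcases lt_trichotomy i k with h | h | h
    · simp [h, h.ne, h.not_gt]
    · simp [h]
    · simp [h, h.ne', h.not_gt]
  have h2 : ∑ i, ∑ k, g i k = ∑ i, ∑ k, ((if i = k then g i k else 0) +
      ((if i < k then g i k else 0) + (if k < i then g i k else 0))) :=
    Finset.sum_congr rfl fun i _ => Finset.sum_congr rfl fun k _ => h1 i k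
  rw [h2]
  simp only [Finset.sum_add_distrib, Finset.sum_ite_eq, Finset.mem_univ, if_true]
  congr 1
  rw [Finset.sum_comm (f := fun i k => if k < i then g i k else 0)]
  simp only [← Finset.sum_add_distrib]
  refine Finset.sum_congr rfl fun p _ => Finset.sum_congr rfl fun r _ => ?_
  split_ifs <;> simp

/-- The column elements `w_j = ∑ x_ij f_i` generate a quantum exterior algebra. -/
lemma IsQM.qext [Fintype ι] {q : K} (hq : q ≠ 0) {x : ι → κ → A} {f : ι → A}
    (hx : IsQM q x) (hf : QExt q f) (hc : ∀ i k j, Commute (f i) (x k j)) :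
    QExt q (fun j => ∑ i, x i j * f i) := by
  have key : ∀ j l, (∑ i, x i j * f i) * (∑ k, x k l * f k) =
      ∑ i, ∑ k, if i < k then (x i j * x k l - q • (x k j * x i l)) * (f i * f k) else 0 := by
    intro j l
    rw [Finset.sum_mul_sum]
    have h0 : ∀ i k, x i j * f i * (x k l * f k) = x i j * x k l * (f i * f k) := by
      intro i k
      rw [mul_assoc, ← mul_assoc (f i), (hc i k l).eq]
      simp only [mul_assoc]
    simp only [h0]
    rw [sum_sum_lt]
    simp only [hf.1, mul_zero, Finset.sum_const_zero, zero_add]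
    refine Finset.sum_congr rfl fun i _ => Finset.sum_congr rfl fun k _ => ?_
    split_ifs with h
    · rw [hf.2 i k h, sub_mul, mul_smul_comm, smul_mul_assoc, neg_smul, sub_eq_add_neg]
    · rfl
  constructor
  · intro j
    rw [key]
    refine Finset.sum_eq_zero fun i _ => Finset.sum_eq_zero fun k _ => ?_
    split_ifs with h
    · rw [hx.col hq h]; simp
    · rfl
  · intro j l hjl
    simp only [key]
    rw [Finset.smul_sum]
    refine Finset.sum_congr rfl fun i _ => ?_
    rw [Finset.smul_sum]
    refine Finset.sum_congr rfl fun k _ => ?_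
    split_ifs with h
    · rw [hx.qrel h hjl, hx.comm h hjl]
      have : x i l * x k j - q • (x k l * x i j) = (-q) • (x k l * x i j +
          (q - q⁻¹) • (x i l * x k j) - q • (x i l * x k j)) := by
        have h1 : -q * q⁻¹ = -1 := by rw [neg_mul, mul_inv_cancel₀ hq]
        simp only [smul_sub, smul_add, sub_smul, smul_smul, h1]
        simp only [neg_smul, neg_mul, one_smul]
        abel
      rw [this, smul_mul_assoc]
    · simp

/-- Row-ordered and column-ordered generating functions of minors agree. -/
lemma IsQM.agree [Fintype ι] {q : K} (hq : q ≠ 0) {x : ι → κ → A} {f : ι → A} {e : κ → A}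
    (hx : IsQM q x) (hf : QExt q f) (he : QExt q e)
    (hc : ∀ i k j, Commute (f i) (x k j)) (hc' : ∀ i k j, Commute (e i) (x k j))
    (hfe : ∀ i j, Commute (f i) (e j)) (U : Finset κ) :
    op (fun j => 1 + (∑ i, x i j * f i) * e j) U =
      op (fun i => 1 + (∑ j ∈ U, x i j * e j) * f i) Finset.univ := by
  have hz : ∀ i k j l, (x i j * f i * e j) * (x k l * f k * e l) =
      x i j * x k l * (f i * f k) * (e j * e l) := by
    intro i k j l
    have h1 := (hc i k l).eq
    have h2 := (hc' j k l).eq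
    have h3 := (hfe k j).eq
    calc _ = x i j * (f i * (e j * x k l)) * f k * e l := by simp only [mul_assoc]
      _ = x i j * x k l * f i * (e j * f k) * e l := by
          rw [h2, ← mul_assoc (f i), h1]; simp only [mul_assoc]
      _ = _ := by rw [← h3]; simp only [mul_assoc]
  have hr : ∀ (V : Finset κ) i, (∑ j ∈ V, x i j * e j) * f i = ∑ j ∈ V, x i j * f i * e j := by
    intro V i
    rw [Finset.sum_mul]
    refine Finset.sum_congr rfl fun j _ => ?_
    rw [mul_assoc, ← (hfe i j).eq, mul_assoc]
  induction U using Finset.induction_on_min with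
  | empty =>
    simp only [op_empty, Finset.sum_empty, zero_mul, add_zero]
    simp [op]
  | insert a U ha ih =>
    have haU : a ∉ U := fun h => lt_irrefl _ (ha a h)
    rw [op_insert _ ha, ih, Finset.sum_mul, ← op_one_add_zero (fun i => x i a * f i * e a),
      op_mul]
    · congr 1
      ext i
      rw [hr, hr, Finset.sum_insert haU, add_mul, one_mul, mul_add, Finset.mul_sum]
      have : ∑ j ∈ U, x i a * f i * e a * (x i j * f i * e j) = 0 :=
        Finset.sum_eq_zero fun j _ => by rw [hz, hf.1]; simp
      rw [this]; simp only [mul_one]; abel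
    · intro i k hik
      rw [hr]
      refine Commute.add_left (Commute.one_left _) (Commute.add_right (Commute.one_right _) ?_)
      refine Commute.sum_right _ _ _ fun j hj => ?_
      have haj := ha j hj
      show _ * _ = _ * _
      rw [hz, hz, hf.2 i k hik, he.2 a j haj, hx.comm hik haj]
      simp only [mul_smul_comm, smul_mul_assoc]
    · intro i k
      rw [hz, he.1, mul_zero]
end QM
end QG

namespace QG
section Pl
universe u v
open TensorProduct
variable {K : Type*} [Field K] {A : Type*} [Ring A] [Algebra K A]
variable {ι κ : Type*} [LinearOrder ι] [LinearOrder κ]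

lemma op_mem_span [Fintype ι] {q : K} {x : ι → κ → A} {f : ι → A} (hf : QExt q f)
    (Sa : Subalgebra K A) (hx : ∀ i j, x i j ∈ Sa) (hc : ∀ i, ∀ a ∈ Sa, Commute (f i) a)
    (U : Finset κ) :
    op (fun j => ∑ i, x i j * f i) U ∈
      Submodule.span K {z | ∃ a ∈ Sa, ∃ R : Finset ι, R.card = U.card ∧ z = a * op f R} := by
  induction U using Finset.induction_on_min with
  | empty => exact Submodule.subset_span ⟨1, Sa.one_mem, ∅, by simp [op_empty]⟩
  | insert b U hb ih =>
    have hbU : b ∉ U := fun h => lt_irrefl _ (hb b h)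
    rw [op_insert _ hb, Finset.sum_mul]
    refine Submodule.sum_mem _ fun i _ => ?_
    generalize op (fun j => ∑ i, x i j * f i) U = z at ih ⊢
    induction ih using Submodule.span_induction with
    | mem z hz =>
      obtain ⟨a, ha, R, hR, rfl⟩ := hz
      have : x i b * f i * (a * op f R) = x i b * a * (f i * op f R) := by
        rw [mul_assoc, ← mul_assoc (f i), (hc i a ha).eq]; simp only [mul_assoc]
      rw [this, hf.mul_op]
      split_ifs with h
      · simp
      · rw [mul_smul_comm]
        refine Submodule.smul_mem _ _ (Submodule.subset_span
          ⟨x i b * a, Sa.mul_mem (hx i b) ha, insert i R, ?_, rfl⟩)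
        rw [Finset.card_insert_of_notMem h, Finset.card_insert_of_notMem hbU, hR]
    | zero => simp
    | add y z _ _ hy hz => rw [mul_add]; exact Submodule.add_mem _ hy hz
    | smul c y _ hy => rw [mul_smul_comm]; exact Submodule.smul_mem _ _ hy

lemma tensor_pack (K : Type*) [Field K] (A : Type u) [Ring A] [Algebra K A]
    (B : Type v) [Ring B] [Algebra K B] :
    ∃ (Z : Type (max u v)) (_ : Ring Z) (_ : Algebra K Z) (inl : A →ₐ[K] Z) (inr : B →ₐ[K] Z),
      (∀ a b, Commute (inr b) (inl a)) ∧
      (∀ co : B →ₗ[K] K, ∃ Φ : Z →ₗ[K] A, ∀ a b, Φ (inl a * inr b) = co b • a) ∧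
      (Nontrivial A → Nontrivial B → Nontrivial Z) := by
  refine ⟨A ⊗[K] B, inferInstance, inferInstance, Algebra.TensorProduct.includeLeft,
    Algebra.TensorProduct.includeRight, ?_, ?_, ?_⟩
  · intro a b
    show _ * _ = _ * _
    simp
  · intro co
    refine ⟨(TensorProduct.rid K A).toLinearMap.comp (LinearMap.lTensor A co), ?_⟩
    intro a b
    simp
  · intro _ _
    infer_instance

lemma theta [Fintype ι] [Fintype κ] {q : K} (hq : q ≠ 0) {x : ι → κ → A} {f g : ι → A}
    (hx : IsQM q x) (hf : QExt q f) (hg : QExt q g) (hfx : ∀ i k j, Commute (f i) (x k j))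
    (hgx : ∀ i k j, Commute (g i) (x k j)) (S0 : Finset κ)
    (hS0 : Fintype.card ι < S0.card) :
    ∑ S ∈ S0.powerset, ((-q) ^ iv S (S0 \ S)) •
      (op (fun j => ∑ i, x i j * f i) S * op (fun j => ∑ i, x i j * g i) (S0 \ S)) = 0 := by
  classical
  obtain ⟨e, he, hco⟩ := exists_qext K q κ
  obtain ⟨Z, _, _, inl, inr, hlr, hpack, -⟩ := tensor_pack K A (Module.End K (Finset κ → K))
  let w := fun j => ∑ i, x i j * f i
  let v := fun j => ∑ i, x i j * g i
  let y : ι → Z := fun i => ∑ j, inl (x i j) * inr (e j)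
  have hx' := hx.map inl
  have he' : QExt q (fun j => inr (e j)) := by
    refine ⟨fun i => by rw [← map_mul, he.1, map_zero], fun i k h => ?_⟩
    rw [← map_mul, he.2 i k h, map_smul, map_mul]
  have hext : ∀ (f : ι → A), QExt q f → QExt q (fun j => inl (f j)) := by
    intro f hf
    refine ⟨fun i => by rw [← map_mul, hf.1, map_zero], fun i k h => ?_⟩
    rw [← map_mul, hf.2 i k h, map_smul, map_mul]
  have hy : QExt q y :=
    hx'.transpose.qext hq he' (fun i k j => hlr _ _)
  have gen : ∀ (f : ι → A), QExt q f → (∀ i k j, Commute (f i) (x k j)) →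
      ∑ S : Finset κ, inl (op (fun j => ∑ i, x i j * f i) S) * inr (op e S) =
        ∑ R : Finset ι, op y R * inl (op f R) := by
    intro f hf hfx
    have h1 := hx'.agree hq (hext f hf) he' (fun i k j => (hfx i k j).map inl)
      (fun i k j => hlr _ _) (fun i j => (hlr _ _).symm) Finset.univ
    rw [op_one_add (fun j => ∑ i, inl (x i j) * inl (f i)) (fun j => inr (e j)),
      op_one_add (fun i => ∑ j, inl (x i j) * inr (e j)) (fun j => inl (f j))] at h1
    · simp only [Finset.powerset_univ] at h1
      simp only [op_map, map_sum, map_mul]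
      exact h1
    · intro i k
      refine Commute.sum_right _ _ _ fun j _ => ?_
      exact Commute.mul_right ((hfx _ _ _).map inl) (hlr _ _).symm
    · intro i j
      refine Commute.sum_right _ _ _ fun k _ => ?_
      exact Commute.mul_right (hlr _ _) (hlr _ _)
  let co : Module.End K (Finset κ → K) →ₗ[K] K :=
    (LinearMap.proj S0).comp (LinearMap.applyₗ (Pi.single ∅ 1))
  have hco' : ∀ S, co (op e S) = if S0 = S then 1 else 0 := fun S => hco S0 S
  obtain ⟨Φ, hΦ⟩ := hpack co
  have hmain := congrArg Φ (congrArg₂ (· * ·) (gen f hf hfx) (gen g hg hgx))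
  have hR : Φ ((∑ R : Finset ι, op y R * inl (op f R)) *
      (∑ R : Finset ι, op y R * inl (op g R))) = 0 := by
    rw [Finset.sum_mul_sum, map_sum]
    refine Finset.sum_eq_zero fun R _ => ?_
    rw [map_sum]
    refine Finset.sum_eq_zero fun Q _ => ?_
    have hcomm : Commute (inl (op f R)) (op y Q) := by
      rw [op_map]
      apply op_commute
      intro i _ k _
      refine Commute.sum_right _ _ _ fun j _ => ?_
      exact Commute.mul_right ((hfx _ _ _).map inl) (hlr _ _).symm
    have : op y R * inl (op f R) * (op y Q * inl (op g Q)) =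
        op y R * op y Q * inl (op f R * op g Q) := by
      rw [mul_assoc, ← mul_assoc (inl _), hcomm.eq, map_mul]; simp only [mul_assoc]
    rw [this, hy.op_mul_op]
    split_ifs with hd
    · rw [smul_mul_assoc, map_smul]
      have hmem := op_mem_span (x := fun j i => inl (x i j)) he' inl.range
        (fun i j => ⟨_, rfl⟩) (by rintro i a ⟨b, rfl⟩; exact hlr _ _) (R ∪ Q)
      have hz : ∀ z ∈ Submodule.span K {z | ∃ a ∈ inl.range, ∃ T : Finset κ,
          T.card = (R ∪ Q).card ∧ z = a * op (fun j => inr (e j)) T},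
          ∀ b, Φ (z * inl b) = 0 := by
        intro z hz b
        induction hz using Submodule.span_induction with
        | mem z hz =>
          obtain ⟨_, ⟨a, rfl⟩, T, hT, rfl⟩ := hz
          have h3 : op (fun j => inr (e j)) T = inr (op e T) := (op_map inr e T).symm
          rw [h3, mul_assoc, (hlr _ _).eq, ← mul_assoc]
          have h4 : inl.toRingHom a = inl a := rfl
          rw [h4, ← map_mul, hΦ, hco', if_neg, zero_smul]
          rintro rfl
          have := Finset.card_le_univ (R ∪ Q)
          omega
        | zero => simp
        | add y z _ _ hy hz => rw [add_mul, map_add, hy, hz, add_zero]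
        | smul c y _ hy => rw [smul_mul_assoc, map_smul, hy, smul_zero]
      have h5 := hz _ hmem (op f R * op g Q)
      have h6 : op y (R ∪ Q) = op (fun j => ∑ i, inl (x j i) * inr (e i)) (R ∪ Q) := rfl
      rw [h6, h5, smul_zero]
    · simp
  have hL : Φ ((∑ S : Finset κ, inl (op w S) * inr (op e S)) *
      (∑ S : Finset κ, inl (op v S) * inr (op e S))) =
      ∑ S ∈ S0.powerset, ((-q) ^ iv S (S0 \ S)) • (op w S * op v (S0 \ S)) := by
    rw [Finset.sum_mul_sum, map_sum]
    have h1 : ∀ S, Φ (∑ T, inl (op w S) * inr (op e S) * (inl (op v T) * inr (op e T))) =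
        if S ⊆ S0 then ((-q) ^ iv S (S0 \ S)) • (op w S * op v (S0 \ S)) else 0 := by
      intro S
      rw [map_sum]
      have h2 : ∀ T, Φ (inl (op w S) * inr (op e S) * (inl (op v T) * inr (op e T))) =
          if S ⊆ S0 ∧ T = S0 \ S then ((-q) ^ iv S T) • (op w S * op v T) else 0 := by
        intro T
        have : inl (op w S) * inr (op e S) * (inl (op v T) * inr (op e T)) =
            inl (op w S * op v T) * inr (op e S * op e T) := by
          rw [mul_assoc, ← mul_assoc (inr _), (hlr _ _).eq, map_mul, map_mul]
          simp only [mul_assoc]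
        rw [this, hΦ, he.op_mul_op]
        by_cases hd : Disjoint S T
        · rw [if_pos hd, map_smul, hco']
          by_cases hST : S0 = S ∪ T
          · rw [if_pos hST, if_pos, smul_eq_mul, mul_one]
            refine ⟨by rw [hST]; exact Finset.subset_union_left, ?_⟩
            rw [hST, Finset.union_sdiff_left, Finset.sdiff_eq_self_of_disjoint hd.symm]
          · rw [if_neg hST, if_neg, smul_zero, zero_smul]
            rintro ⟨h, rfl⟩
            exact hST (Finset.union_sdiff_of_subset h).symm
        · rw [if_neg hd, map_zero, zero_smul, if_neg]
          rintro ⟨h, rfl⟩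
          exact hd Finset.disjoint_sdiff
      simp only [h2]
      by_cases h : S ⊆ S0
      · simp [h]
      · simp [h]
    simp only [h1]
    rw [← Finset.sum_filter]
    congr 1
    ext S; simp
  rw [← hL]
  exact hmain.trans hR

end Pl
end QG

namespace QG
section Minor
variable {K : Type*} [Field K] {A : Type*} [Ring A] [Algebra K A]
variable {ι κ : Type*} [LinearOrder ι] [LinearOrder κ]

/-- Number of inversions of a function. -/
def invr {t : ℕ} (r : Fin t → ι) : ℕ :=
  ((Finset.univ : Finset (Fin t × Fin t)).filter fun p => p.1 < p.2 ∧ r p.2 < r p.1).card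

lemma invr_succ {t : ℕ} (r : Fin (t + 1) → ι) :
    invr r = (Finset.univ.filter fun k : Fin t => r k.succ < r 0).card +
      invr (fun k => r k.succ) := by
  simp only [invr, Finset.card_filter]
  rw [Fintype.sum_prod_type, Fintype.sum_prod_type, Fin.sum_univ_succ]
  congr 1
  · rw [Fin.sum_univ_succ]; simp
  · refine Finset.sum_congr rfl fun i _ => ?_
    rw [Fin.sum_univ_succ]; simp

lemma QExt.ofFn_prod {q : K} {f : ι → A} (hf : QExt q f) {t : ℕ} (r : Fin t → ι) :
    (List.ofFn (fun k => f (r k))).prod = if Function.Injective r then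
      ((-q) ^ invr r) • op f (Finset.univ.image r) else 0 := by
  classical
  induction t with
  | zero =>
    rw [if_pos (Function.injective_of_subsingleton r)]
    simp [invr, op_empty]
  | succ t ih =>
    rw [List.ofFn_succ, List.prod_cons, ih (fun k => r k.succ)]
    have himg : Finset.univ.image r = insert (r 0) (Finset.univ.image fun k : Fin t => r k.succ) := by
      ext a; simp [Fin.exists_fin_succ, eq_comm]
    have hinj : Function.Injective r ↔ (r 0 ∉ Finset.univ.image fun k : Fin t => r k.succ) ∧
        Function.Injective fun k : Fin t => r k.succ := by
      have h := Fin.cons_injective_iff (x₀ := r 0) (x := fun k : Fin t => r k.succ)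
      have h2 : (Fin.cons (r 0) (fun k : Fin t => r k.succ) : Fin (t+1) → ι) = r :=
        Fin.cons_self_tail r
      rw [h2] at h
      rw [h]; simp
    by_cases h1 : Function.Injective fun k : Fin t => r k.succ
    · rw [if_pos h1, mul_smul_comm, hf.mul_op]
      by_cases h2 : r 0 ∈ Finset.univ.image fun k : Fin t => r k.succ
      · rw [if_pos h2, if_neg (fun h => (hinj.1 h).1 h2), smul_zero]
      · rw [if_neg h2, if_pos (hinj.2 ⟨h2, h1⟩), himg, smul_smul, invr_succ, ← pow_add, add_comm]
        congr 3
        rw [Finset.filter_image, Finset.card_image_of_injective _ h1]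
    · rw [if_neg h1, mul_zero, if_neg (fun h => h1 (hinj.1 h).2)]

lemma op_eq_ofFn (g : ι → A) {t : ℕ} (J : Finset ι) (h : J.card = t) :
    op g J = (List.ofFn fun k => g (J.orderEmbOfFin h k)).prod := by
  unfold op
  rw [← Finset.listMap_orderEmbOfFin_finRange J h, List.map_map, List.ofFn_eq_map]
  rfl

lemma ofFn_mul_prod {t : ℕ} (a b : Fin t → A) (h : ∀ i j, Commute (b i) (a j)) :
    (List.ofFn fun k => a k * b k).prod = (List.ofFn a).prod * (List.ofFn b).prod := by
  induction t with
  | zero => simp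
  | succ t ih =>
    simp only [List.ofFn_succ, List.prod_cons]
    rw [ih _ _ (fun i j => h _ _)]
    have : Commute (b 0) (List.ofFn fun k : Fin t => a k.succ).prod := by
      apply Commute.list_prod_right
      intro x hx
      rw [List.mem_ofFn] at hx
      obtain ⟨k, rfl⟩ := hx
      exact h _ _
    rw [mul_assoc, ← mul_assoc (b 0), this.eq]; simp only [mul_assoc]

lemma ofFn_sum_prod {t : ℕ} [Fintype ι] (a : Fin t → ι → A) :
    (List.ofFn fun k => ∑ i, a k i).prod = ∑ r : Fin t → ι, (List.ofFn fun k => a k (r k)).prod := by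
  classical
  have := (MultilinearMap.mkPiAlgebraFin ℤ t A).map_sum a
  simpa [MultilinearMap.mkPiAlgebraFin_apply] using this

lemma op_eq_minor {q : K} {m : ℕ} {x : Fin m → κ → A} {f : Fin m → A}
    (hf : QExt q f) (hfx : ∀ i k j, Commute (f i) (x k j)) (J : Finset κ) (h : J.card = m) :
    op (fun j => ∑ i, x i j * f i) J =
      qMinor K q m (fun i k => x i (J.orderEmbOfFin h k)) * op f Finset.univ := by
  classical
  rw [op_eq_ofFn _ J h, ofFn_sum_prod]
  have h1 : ∀ r : Fin m → Fin m, (List.ofFn fun k => x (r k) (J.orderEmbOfFin h k) * f (r k)).prod =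
      (List.ofFn fun k => x (r k) (J.orderEmbOfFin h k)).prod *
        (if Function.Injective r then ((-q) ^ invr r) • op f (Finset.univ.image r) else 0) := by
    intro r
    rw [ofFn_mul_prod _ _ (fun i j => hfx _ _ _), hf.ofFn_prod]
  simp only [h1]
  rw [qMinor, Finset.sum_mul]
  symm
  refine Finset.sum_of_injOn (fun σ : Equiv.Perm (Fin m) => (σ : Fin m → Fin m)) ?_ ?_ ?_ ?_
  · intro a _ b _ hab; exact DFunLike.coe_injective hab
  · intro a _; simp
  · intro r _ hr
    rw [if_neg, mul_zero]
    intro hi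
    apply hr
    exact ⟨Equiv.ofBijective r (Finite.injective_iff_bijective.1 hi), by simp, rfl⟩
  · intro σ _
    rw [if_pos σ.injective, Finset.image_univ_equiv, mul_smul_comm, smul_mul_assoc]
    rfl

lemma op_eq_zero [Fintype ι] {q : K} {x : ι → κ → A} {f : ι → A}
    (hf : QExt q f) (hfx : ∀ i k j, Commute (f i) (x k j)) (U : Finset κ)
    (h : Fintype.card ι < U.card) : op (fun j => ∑ i, x i j * f i) U = 0 := by
  have := op_mem_span hf (Subalgebra.centralizer K (Set.range f)) (x := x)
    (by
      intro i j
      rw [Subalgebra.mem_centralizer_iff]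
      rintro _ ⟨k, rfl⟩
      exact (hfx k i j).eq)
    (by
      intro i a ha
      rw [Subalgebra.mem_centralizer_iff] at ha
      exact ha _ ⟨i, rfl⟩) U
  have he : {z | ∃ a ∈ Subalgebra.centralizer K (Set.range f), ∃ R : Finset ι,
      R.card = U.card ∧ z = a * op f R} = ∅ := by
    rw [Set.eq_empty_iff_forall_notMem]
    rintro z ⟨a, _, R, hR, _⟩
    have := Finset.card_le_univ R
    omega
  rw [he, Submodule.span_empty, Submodule.mem_bot] at this
  exact this

lemma X_isQM {q : K} (hq : q ≠ 0) (m n : ℕ) : IsQM q (fun (i : Fin m) (j : Fin n) => X K q i j) := by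
  apply IsQM.of_rel hq
  · intro i j l h
    have := RingQuot.mkAlgHom_rel K (QMatRel.row (K := K) (q := q) i j l h)
    simpa [X] using this
  · intro i k j h
    have := RingQuot.mkAlgHom_rel K (QMatRel.col (K := K) (q := q) i k j h)
    simpa [X] using this
  · intro i k j l h h'
    have := RingQuot.mkAlgHom_rel K (QMatRel.comm (K := K) (q := q) i k j l h h')
    simpa [X] using this
  · intro i k j l h h'
    have := RingQuot.mkAlgHom_rel K (QMatRel.qrel (K := K) (q := q) i k j l h h')
    simp only [map_sub, map_mul, map_smul] at this
    exact this

end Minor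
end QG

namespace QG
section Pluck
variable {K : Type*} [Field K] {A : Type*} [Ring A] [Algebra K A]

lemma qMinor_map {C : Type*} [Ring C] [Algebra K C] (φ : A →ₐ[K] C) (q : K) (t : ℕ)
    (x : Fin t → Fin t → A) :
    φ (qMinor K q t x) = qMinor K q t (fun i j => φ (x i j)) := by
  simp [qMinor, map_list_prod, List.map_ofFn, Function.comp_def]

/-- Maximal minors of a quantum matrix in an arbitrary algebra. -/
noncomputable def gMinor (q : K) {m n : ℕ} (x : Fin m → Fin n → A) (J : Finset (Fin n)) : A :=
  if h : J.card = m then qMinor K q m (fun i k => x i (J.orderEmbOfFin h k)) else 0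

lemma gMinor_map {C : Type*} [Ring C] [Algebra K C] (φ : A →ₐ[K] C) (q : K) {m n : ℕ}
    (x : Fin m → Fin n → A) (J : Finset (Fin n)) :
    φ (gMinor q x J) = gMinor q (fun i j => φ (x i j)) J := by
  unfold gMinor
  split_ifs
  · rw [qMinor_map]
  · simp

lemma gMinor_commute {q : K} {m n : ℕ} {x : Fin m → Fin n → A} {a : A}
    (h : ∀ i j, Commute a (x i j)) (J : Finset (Fin n)) : Commute a (gMinor q x J) := by
  unfold gMinor
  split_ifs
  · unfold qMinor
    refine Commute.sum_right _ _ _ fun σ _ => ?_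
    refine Commute.smul_right ?_ _
    apply Commute.list_prod_right
    intro y hy
    rw [List.mem_ofFn] at hy
    obtain ⟨k, rfl⟩ := hy
    exact h _ _
  · exact Commute.zero_right _

lemma op_mul_gMinor {q : K} {m n : ℕ} {x : Fin m → Fin n → A} {f g : Fin m → A}
    (hf : QExt q f) (hg : QExt q g) (hfx : ∀ i k j, Commute (f i) (x k j))
    (hgx : ∀ i k j, Commute (g i) (x k j)) (U V : Finset (Fin n))
    (h : U.card + V.card = 2 * m) :
    op (fun j => ∑ i, x i j * f i) U * op (fun j => ∑ i, x i j * g i) V =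
      gMinor q x U * gMinor q x V * (op f Finset.univ * op g Finset.univ) := by
  rcases lt_trichotomy U.card m with h1 | h1 | h1
  · rw [op_eq_zero hg hgx V (by rw [Fintype.card_fin]; omega), gMinor, dif_neg h1.ne]
    simp
  · have h2 : V.card = m := by omega
    rw [op_eq_minor hf hfx U h1, op_eq_minor hg hgx V h2]
    have e1 : gMinor q x U = qMinor K q m (fun i k => x i (U.orderEmbOfFin h1 k)) := by
      rw [gMinor, dif_pos h1]
    have e2 : gMinor q x V = qMinor K q m (fun i k => x i (V.orderEmbOfFin h2 k)) := by
      rw [gMinor, dif_pos h2]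
    rw [← e1, ← e2]
    have hc : Commute (op f Finset.univ) (gMinor q x V) := by
      apply Commute.symm
      unfold op
      apply Commute.list_prod_right
      intro y hy
      rw [List.mem_map] at hy
      obtain ⟨i, _, rfl⟩ := hy
      exact (gMinor_commute (fun k j => hfx i k j) V).symm
    rw [mul_assoc, ← mul_assoc (op f _), hc.eq]
    simp only [mul_assoc]
  · rw [op_eq_zero hf hfx U (by rw [Fintype.card_fin]; omega), gMinor, dif_neg h1.ne']
    simp

lemma plucker_abs {q : K} (hq : q ≠ 0) {m n : ℕ} {x : Fin m → Fin n → A} {f g : Fin m → A}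
    (hx : IsQM q x) (hf : QExt q f) (hg : QExt q g) (hfx : ∀ i k j, Commute (f i) (x k j))
    (hgx : ∀ i k j, Commute (g i) (x k j)) (A0 K0 L : Finset (Fin n))
    (h : A0.card + K0.card + L.card = 2 * m) (hK : m < K0.card) :
    (∑ S ∈ K0.powerset, if Disjoint A0 S ∧ Disjoint (K0 \ S) L then
      ((-q) ^ (iv A0 S + iv S (K0 \ S) + iv (K0 \ S) L)) •
        (gMinor q x (A0 ∪ S) * gMinor q x ((K0 \ S) ∪ L)) else 0) *
      (op f Finset.univ * op g Finset.univ) = 0 := by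
  have hw := hx.qext hq hf hfx
  have hv := hx.qext hq hg hgx
  have ht := theta hq hx hf hg hfx hgx K0 (by rw [Fintype.card_fin]; exact hK)
  have ht2 := congrArg (fun z => op (fun j => ∑ i, x i j * f i) A0 * z *
    op (fun j => ∑ i, x i j * g i) L) ht
  simp only [mul_zero, zero_mul, Finset.mul_sum, Finset.sum_mul] at ht2
  rw [Finset.sum_mul]
  refine Eq.trans ?_ ht2
  refine Finset.sum_congr rfl fun S hS => ?_
  rw [Finset.mem_powerset] at hS
  have e : op (fun j => ∑ i, x i j * f i) A0 * ((-q) ^ iv S (K0 \ S) •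
      (op (fun j => ∑ i, x i j * f i) S * op (fun j => ∑ i, x i j * g i) (K0 \ S))) *
      op (fun j => ∑ i, x i j * g i) L = (-q) ^ iv S (K0 \ S) •
        ((op (fun j => ∑ i, x i j * f i) A0 * op (fun j => ∑ i, x i j * f i) S) *
        (op (fun j => ∑ i, x i j * g i) (K0 \ S) * op (fun j => ∑ i, x i j * g i) L)) := by
    rw [mul_smul_comm, smul_mul_assoc]; simp only [mul_assoc]
  rw [e, hw.op_mul_op, hv.op_mul_op]
  by_cases h1 : Disjoint A0 S
  · by_cases h2 : Disjoint (K0 \ S) L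
    · rw [if_pos ⟨h1, h2⟩, if_pos h1, if_pos h2, smul_mul_smul_comm, smul_smul, op_mul_gMinor hf hg hfx hgx,
        smul_mul_assoc, ← pow_add, ← pow_add]
      · congr 2; ring
      · rw [Finset.card_union_of_disjoint h1, Finset.card_union_of_disjoint h2,
          Finset.card_sdiff_of_subset hS]
        have := Finset.card_le_card hS
        omega
    · rw [if_neg (fun h => h2 h.2), if_neg h2]; simp
  · rw [if_neg (fun h => h1 h.1), if_neg h1]; simp

lemma QExt.map {ι : Type*} [LinearOrder ι] {q : K} {f : ι → A} (hf : QExt q f)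
    {C : Type*} [Ring C] [Algebra K C] (φ : A →ₐ[K] C) : QExt q (fun i => φ (f i)) := by
  refine ⟨fun i => by rw [← map_mul, hf.1, map_zero], fun i k h => ?_⟩
  rw [← map_mul, hf.2 i k h, map_smul, map_mul]

lemma plucker {q : K} (hq : q ≠ 0) {m n : ℕ} (A0 K0 L : Finset (Fin n))
    (h : A0.card + K0.card + L.card = 2 * m) (hK : m < K0.card) :
    (∑ S ∈ K0.powerset, if Disjoint A0 S ∧ Disjoint (K0 \ S) L then
      ((-q) ^ (iv A0 S + iv S (K0 \ S) + iv (K0 \ S) L)) •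
        (grMinor K q m (A0 ∪ S) * grMinor K q m ((K0 \ S) ∪ L)) else 0) = 0 := by
  obtain ⟨e, he, hco⟩ := exists_qext K q (Fin m)
  obtain ⟨Z1, _, _, inl1, inr1, hlr1, hp1, -⟩ :=
    tensor_pack K (QMat K q m n) (Module.End K (Finset (Fin m) → K))
  obtain ⟨Z, _, _, inl2, inr2, hlr2, hp2, -⟩ :=
    tensor_pack K Z1 (Module.End K (Finset (Fin m) → K))
  let co : Module.End K (Finset (Fin m) → K) →ₗ[K] K :=
    (LinearMap.proj Finset.univ).comp (LinearMap.applyₗ (Pi.single ∅ 1))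
  have hco' : co (op e Finset.univ) = 1 := by
    have := hco Finset.univ Finset.univ
    rw [if_pos rfl] at this
    exact this
  obtain ⟨Φ1, hΦ1⟩ := hp1 co
  obtain ⟨Φ2, hΦ2⟩ := hp2 co
  have hm : ∀ J : Finset (Fin n), gMinor q (fun i j => inl2 (inl1 (X K q i j))) J =
      inl2 (inl1 (grMinor K q m J)) := by
    intro J
    rw [← gMinor_map inl2 q (fun i j => inl1 (X K q i j)), ← gMinor_map inl1]
    rfl
  have main := plucker_abs hq (((X_isQM (K := K) hq m n).map inl1).map inl2)
    ((he.map inr1).map inl2) (he.map inr2)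
    (fun i k j => (hlr1 _ _).map inl2) (fun i k j => hlr2 _ _) A0 K0 L h hK
  simp only [hm, ← map_mul, ← map_smul] at main
  rw [← op_map inr2 e, ← op_map inl2 (fun i => inr1 (e i)), ← op_map inr1 e] at main
  have e1 : ∀ (p : Prop) [Decidable p] (a : QMat K q m n),
      (if p then inl2 (inl1 a) else 0) = inl2 (inl1 (if p then a else 0)) := by
    intro p _ a; split_ifs <;> simp
  simp only [e1, ← map_sum] at main
  rw [← mul_assoc, ← map_mul] at main
  have m2 := congrArg Φ1 (congrArg Φ2 main)
  rw [hΦ2, hco', one_smul, hΦ1, hco', one_smul, map_zero, map_zero] at m2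
  exact m2

end Pluck
end QG

namespace QG
section Str
variable {K : Type*} [Field K]

lemma iv_union_left {ι : Type*} [LinearOrder ι] {S T : Finset ι} (h : Disjoint S T)
    (U : Finset ι) : iv (S ∪ T) U = iv S U + iv T U := by
  unfold iv; rw [Finset.sum_union h]

lemma iv_union_right {ι : Type*} [LinearOrder ι] {S T : Finset ι} (h : Disjoint S T)
    (U : Finset ι) : iv U (S ∪ T) = iv U S + iv U T := by
  unfold iv
  rw [← Finset.sum_add_distrib]
  refine Finset.sum_congr rfl fun u _ => ?_
  rw [Finset.filter_union, Finset.card_union_of_disjoint]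
  exact Finset.disjoint_filter_filter h

lemma iv_add_symm {ι : Type*} [LinearOrder ι] {S T : Finset ι} (h : Disjoint S T) :
    iv S T + iv T S = S.card * T.card := by
  have h1 : iv T S = ∑ s ∈ S, (T.filter (s < ·)).card := by
    unfold iv
    simp only [Finset.card_filter]
    rw [Finset.sum_comm]
  rw [h1]
  unfold iv
  rw [← Finset.sum_add_distrib, ← smul_eq_mul, ← Finset.sum_const]
  refine Finset.sum_congr rfl fun s hs => ?_
  rw [← Finset.card_union_of_disjoint]
  · congr 1
    ext t
    simp only [Finset.mem_union, Finset.mem_filter]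
    constructor
    · rintro (h | h) <;> exact h.1
    · intro ht
      rcases lt_trichotomy t s with h2 | h2 | h2
      · exact Or.inl ⟨ht, h2⟩
      · exact absurd (h2 ▸ ht) (Finset.disjoint_left.1 h hs)
      · exact Or.inr ⟨ht, h2⟩
  · rw [Finset.disjoint_left]
    intro a ha hb
    exact lt_asymm (Finset.mem_filter.1 ha).2 (Finset.mem_filter.1 hb).2

/-- Formal quantum Plücker element. -/
noncomputable def plE (q : K) (m : ℕ) {n : ℕ} (A0 K0 L : Finset (Fin n)) :
    (Finset (Fin n) × Finset (Fin n)) →₀ K :=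
  ∑ S ∈ K0.powerset, if Disjoint A0 S ∧ Disjoint (K0 \ S) L ∧ (A0 ∪ S).card = m then
    Finsupp.single (A0 ∪ S, (K0 \ S) ∪ L) ((-q) ^ (iv A0 S + iv S (K0 \ S) + iv (K0 \ S) L)) else 0

/-- Span of the formal quantum Plücker elements. -/
noncomputable def Plk (q : K) (m n : ℕ) : Submodule K ((Finset (Fin n) × Finset (Fin n)) →₀ K) :=
  Submodule.span K {z | ∃ A0 K0 L : Finset (Fin n), A0.card + K0.card + L.card = 2 * m ∧
    m < K0.card ∧ z = plE q m A0 K0 L}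

/-- Standard pairs. -/
def IsStd (m : ℕ) {n : ℕ} (T : Finset (Fin n) × Finset (Fin n)) : Prop :=
  T.1.card = m ∧ T.2.card = m ∧
    ∀ x, (T.2.filter (· ≤ x)).card ≤ (T.1.filter (· ≤ x)).card

lemma sum_lt_exch {n : ℕ} (x : Fin n) (S0 T0 S : Finset (Fin n)) (hS0 : ∀ s ∈ S0, x < s)
    (hT0 : ∀ t ∈ T0, t ≤ x) (hS : S ⊆ S0 ∪ T0) (hc : S.card = S0.card) (hne : S ≠ S0) :
    ∑ s ∈ S, (s : ℕ) < ∑ s ∈ S0, (s : ℕ) := by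
  have h1 := Finset.sum_inter_add_sum_sdiff S S0 (fun s => (s : ℕ))
  have h2 := Finset.sum_inter_add_sum_sdiff S0 S (fun s => (s : ℕ))
  have hcard : (S \ S0).card = (S0 \ S).card := by
    have a1 := Finset.card_sdiff_add_card_inter S S0
    have a2 := Finset.card_sdiff_add_card_inter S0 S
    rw [Finset.inter_comm] at a2
    omega
  have hpos : (S0 \ S).Nonempty := by
    rw [Finset.nonempty_iff_ne_empty]
    intro h
    rw [h, Finset.card_empty, Finset.card_eq_zero, Finset.sdiff_eq_empty_iff_subset] at hcard
    rw [Finset.sdiff_eq_empty_iff_subset] at h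
    exact hne (Finset.Subset.antisymm hcard h)
  have b1 : ∑ s ∈ S \ S0, (s : ℕ) ≤ (S \ S0).card • (x : ℕ) := by
    apply Finset.sum_le_card_nsmul
    intro s hs
    rw [Finset.mem_sdiff] at hs
    rcases Finset.mem_union.1 (hS hs.1) with h | h
    · exact absurd h hs.2
    · exact hT0 s h
  have b2 : (S0 \ S).card • ((x : ℕ) + 1) ≤ ∑ s ∈ S0 \ S, (s : ℕ) := by
    apply Finset.card_nsmul_le_sum
    intro s hs
    exact hS0 s (Finset.mem_sdiff.1 hs).1
  rw [Finset.inter_comm] at h2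
  have := hpos.card_pos
  simp only [smul_eq_mul] at b1 b2
  rw [hcard] at b1
  rw [mul_add] at b2
  omega

lemma straighten {q : K} (hq : q ≠ 0) (m n : ℕ) (N : ℕ) :
    ∀ I J : Finset (Fin n), I.card = m → J.card = m → ∑ s ∈ I, (s : ℕ) = N →
      Finsupp.single (I, J) (1 : K) ∈ Plk q m n ⊔ Finsupp.supported K K {T | IsStd m T} := by
  induction N using Nat.strong_induction_on with
  | _ N ih =>
  intro I J hI hJ hN
  by_cases hstd : IsStd m (I, J)
  · exact Submodule.mem_sup_right (Finsupp.single_mem_supported K 1 hstd)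
  · have : ∃ x, (I.filter (· ≤ x)).card < (J.filter (· ≤ x)).card := by
      by_contra hcon
      push Not at hcon
      exact hstd ⟨hI, hJ, hcon⟩
    obtain ⟨x, hx⟩ := this
    set A0 := I.filter (· ≤ x) with hA0
    set S0 := I.filter (¬ · ≤ x) with hS0
    set T0 := J.filter (· ≤ x) with hT0
    set L := J.filter (¬ · ≤ x) with hL
    have cI : A0.card + S0.card = m := by
      rw [← hI]; exact Finset.card_filter_add_card_filter_not _
    have cJ : T0.card + L.card = m := by
      rw [← hJ]; exact Finset.card_filter_add_card_filter_not _
    have uI : A0 ∪ S0 = I := Finset.filter_union_filter_not_eq _ _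
    have uJ : T0 ∪ L = J := Finset.filter_union_filter_not_eq _ _
    have dI : Disjoint A0 S0 := Finset.disjoint_filter_filter_not _ _ _
    have dJ : Disjoint T0 L := Finset.disjoint_filter_filter_not _ _ _
    have dST : Disjoint S0 T0 := by
      rw [Finset.disjoint_left]
      intro a ha hb
      exact (Finset.mem_filter.1 ha).2 (Finset.mem_filter.1 hb).2
    have hsd : (S0 ∪ T0) \ S0 = T0 := by
      rw [Finset.union_sdiff_left, Finset.sdiff_eq_self_of_disjoint dST.symm]
    have cK : (S0 ∪ T0).card = S0.card + T0.card := Finset.card_union_of_disjoint dST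
    have hmem : plE q m A0 (S0 ∪ T0) L ∈ Plk q m n ⊔ Finsupp.supported K K {T | IsStd m T} :=
      Submodule.mem_sup_left (Submodule.subset_span
        ⟨A0, S0 ∪ T0, L, by omega, by omega, rfl⟩)
    unfold plE at hmem
    rw [← Finset.add_sum_erase _ _ (Finset.mem_powerset.2 (Finset.subset_union_left (s₁ := S0) (s₂ := T0)))] at hmem
    rw [Submodule.add_mem_iff_left] at hmem
    · rw [hsd, if_pos ⟨dI, dJ, by rw [uI, hI]⟩, uI, uJ, ← mul_one (_ ^ _), ← smul_eq_mul,
        ← Finsupp.smul_single] at hmem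
      exact (Submodule.smul_mem_iff _ (pow_ne_zero _ (neg_ne_zero.2 hq))).1 hmem
    · refine Submodule.sum_mem _ fun S hS => ?_
      rw [Finset.mem_erase, Finset.mem_powerset] at hS
      split_ifs with hc
      · obtain ⟨c1, c2, c3⟩ := hc
        have c4 := c3
        rw [Finset.card_union_of_disjoint c1] at c4
        have hlt := sum_lt_exch x S0 T0 S
          (fun s hs => not_le.1 (Finset.mem_filter.1 hs).2)
          (fun s hs => (Finset.mem_filter.1 hs).2) hS.2 (by omega) hS.1
        have c5 : (((S0 ∪ T0) \ S) ∪ L).card = m := by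
          rw [Finset.card_union_of_disjoint c2, Finset.card_sdiff_of_subset hS.2]
          have := Finset.card_le_card hS.2
          omega
        rw [← mul_one (_ ^ _), ← smul_eq_mul, ← Finsupp.smul_single]
        refine Submodule.smul_mem _ _ (ih _ ?_ _ _ c3 c5 rfl)
        rw [← hN, ← uI, Finset.sum_union c1, Finset.sum_union dI]
        omega
      · exact Submodule.zero_mem _

lemma phi_f_kills {q : K} (hq : q ≠ 0) (m n : ℕ) (z) (hz : z ∈ Plk q m n) :
    Finsupp.linearCombination K (fun T : Finset (Fin n) × Finset (Fin n) =>
      grMinor K q m T.1 * grMinor K q m T.2) z = 0 := by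
  rw [← LinearMap.mem_ker]
  revert z
  show Plk q m n ≤ _
  rw [Plk, Submodule.span_le]
  rintro _ ⟨A0, K0, L, h1, h2, rfl⟩
  rw [SetLike.mem_coe, LinearMap.mem_ker, ← plucker hq A0 K0 L h1 h2, plE, map_sum]
  refine Finset.sum_congr rfl fun S hS => ?_
  by_cases h : Disjoint A0 S ∧ Disjoint (K0 \ S) L
  · by_cases h3 : (A0 ∪ S).card = m
    · rw [if_pos ⟨h.1, h.2, h3⟩, if_pos h, Finsupp.linearCombination_single]
    · rw [if_neg (fun h' => h3 h'.2.2), if_pos h, map_zero]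
      rw [grMinor, dif_neg h3]; simp
  · rw [if_neg (fun h' => h ⟨h'.1, h'.2.1⟩), if_neg h, map_zero]

lemma phi_g_kills {q : K} (hq : q ≠ 0) (m n : ℕ) (P : Finset (Fin n)) (z) (hz : z ∈ Plk q m n) :
    Finsupp.linearCombination K (fun T : Finset (Fin n) × Finset (Fin n) =>
      if T.1 ∪ T.2 ⊆ P then grMinor K q (m + Pᶜ.card) (T.1 ∪ Pᶜ) *
        grMinor K q (m + Pᶜ.card) (T.2 ∪ Pᶜ) else 0) z = 0 := by
  rw [← LinearMap.mem_ker]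
  revert z
  show Plk q m n ≤ _
  rw [Plk, Submodule.span_le]
  rintro _ ⟨A0, K0, L, h1, h2, rfl⟩
  rw [SetLike.mem_coe, LinearMap.mem_ker, plE, map_sum]
  have hU : ∀ S ⊆ K0, A0 ∪ S ∪ (K0 \ S ∪ L) = A0 ∪ K0 ∪ L := by
    intro S hS
    rw [← Finset.union_assoc, Finset.union_assoc A0, Finset.union_sdiff_of_subset hS]
  by_cases hP : A0 ∪ K0 ∪ L ⊆ P
  · set C := Pᶜ with hC
    have dC : ∀ S ⊆ P, Disjoint S C := by
      intro S hS
      rw [hC, ← le_compl_iff_disjoint_right, compl_compl]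
      exact hS
    have dA : Disjoint A0 C := dC _ fun a ha => hP (by simp [ha])
    have dK : Disjoint K0 C := dC _ fun a ha => hP (by simp [ha])
    have dL : Disjoint L C := dC _ fun a ha => hP (by simp [ha])
    have hpl := plucker (K := K) hq (m := m + C.card) A0 (K0 ∪ C) (L ∪ C)
      (by rw [Finset.card_union_of_disjoint dK, Finset.card_union_of_disjoint dL]; omega)
      (by rw [Finset.card_union_of_disjoint dK]; omega)
    have hq0 : (-q) ^ (iv A0 C + C.card * (K0.card - (m - A0.card))) ≠ 0 :=
      pow_ne_zero _ (neg_ne_zero.2 hq)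
    rw [← (smul_right_injective _ hq0).eq_iff]
    simp only [smul_zero]
    rw [← hpl, Finset.smul_sum]
    refine Finset.sum_of_injOn (fun S => S ∪ C) ?_ ?_ ?_ ?_
    · intro S hS T hT hST
      have hS' : S ⊆ K0 := by simpa using hS
      have hT' : T ⊆ K0 := by simpa using hT
      have e1 := congrArg (fun Z => Z \ C) hST
      simp only [Finset.union_sdiff_right] at e1
      rwa [Finset.sdiff_eq_self_of_disjoint (Finset.disjoint_of_subset_left hS' dK),
        Finset.sdiff_eq_self_of_disjoint (Finset.disjoint_of_subset_left hT' dK)] at e1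
    · intro S hS
      have hS' : S ⊆ K0 := by simpa using hS
      simp only [Finset.coe_powerset, Set.mem_preimage, Set.mem_powerset_iff, Finset.coe_subset]
      exact Finset.union_subset_union_left hS'
    · intro S hS hS2
      rw [if_neg]
      rintro ⟨e1, e2⟩
      apply hS2
      rw [Finset.mem_powerset] at hS
      refine ⟨S \ C, ?_, ?_⟩
      · simp only [Finset.coe_powerset, Set.mem_preimage, Set.mem_powerset_iff, Finset.coe_subset]
        intro a ha
        rw [Finset.mem_sdiff] at ha
        exact (Finset.mem_union.1 (hS ha.1)).resolve_right ha.2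
      · show S \ C ∪ C = S
        apply Finset.sdiff_union_of_subset
        intro a ha
        by_contra hn
        exact Finset.disjoint_left.1 e2 (Finset.mem_sdiff.2 ⟨Finset.mem_union_right _ ha, hn⟩)
          (Finset.mem_union_right _ ha)
    · intro S hS
      rw [Finset.mem_powerset] at hS
      have dS : Disjoint S C := Finset.disjoint_of_subset_left hS dK
      have dT : Disjoint (K0 \ S) C := Finset.disjoint_of_subset_left Finset.sdiff_subset dK
      have eT : (K0 ∪ C) \ (S ∪ C) = K0 \ S := by
        ext a
        have : a ∈ K0 → a ∉ C := fun h => Finset.disjoint_left.1 dK h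
        simp only [Finset.mem_sdiff, Finset.mem_union]; tauto
      rw [eT]
      simp only [Finset.disjoint_union_right, dA, dT, and_true]
      by_cases h : Disjoint A0 S ∧ Disjoint (K0 \ S) L
      · have cU : (A0 ∪ (S ∪ C)).card = (A0 ∪ S).card + C.card := by
          rw [← Finset.union_assoc, Finset.card_union_of_disjoint]
          rw [Finset.disjoint_union_left]; exact ⟨dA, dS⟩
        by_cases h3 : (A0 ∪ S).card = m
        · rw [if_pos ⟨h.1, h.2, h3⟩, if_pos h, Finsupp.linearCombination_single, if_pos, smul_smul,
            ← pow_add]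
          · have e1 : A0 ∪ S ∪ C = A0 ∪ (S ∪ C) := Finset.union_assoc _ _ _
            have e2 : K0 \ S ∪ L ∪ C = K0 \ S ∪ (L ∪ C) := Finset.union_assoc _ _ _
            rw [e1, e2]
            congr 2
            rw [iv_union_right dS, iv_union_left dS, iv_union_right dL]
            have e3 := iv_add_symm dT
            have e4 : (K0 \ S).card = K0.card - (m - A0.card) := by
              rw [Finset.card_sdiff_of_subset hS]
              rw [Finset.card_union_of_disjoint h.1] at h3
              omega
            rw [← e4, mul_comm C.card, ← e3]
            ring
          · rw [hU S hS]; exact hP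
        · rw [if_neg (fun h' => h3 h'.2.2), if_pos h, map_zero, smul_zero]
          rw [grMinor, dif_neg (by rw [cU]; omega)]; simp
      · rw [if_neg (fun h' => h ⟨h'.1, h'.2.1⟩), if_neg h, map_zero, smul_zero]
  · refine Finset.sum_eq_zero fun S hS => ?_
    rw [Finset.mem_powerset] at hS
    split_ifs with h
    · rw [Finsupp.linearCombination_single, if_neg, smul_zero]
      rw [hU S hS]; exact hP
    · simp

end Str
end QG

namespace QG
section Band
universe u
variable {K : Type u} [Field K]

lemma exists_torus {q : K} (hq : q ≠ 0) {σ : Type} [Fintype σ] [DecidableEq σ] (θ : σ → σ → ℤ) :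
    ∃ (C : Type u) (_ : Ring C) (_ : Algebra K C) (t : σ → C), Nontrivial C ∧
      (∀ s, IsUnit (t s)) ∧ ∀ s r, t s * t r = q ^ (θ r s - θ s r) • (t r * t s) := by
  let t : σ → Module.End K ((σ → ℤ) → K) := fun s =>
    { toFun := fun φ g => q ^ (∑ r, θ s r * g r) * φ (g + Pi.single s 1)
      map_add' := by intro a b; ext g; simp [mul_add]
      map_smul' := by intro a b; ext g; simp [mul_left_comm] }
  have ht : ∀ s φ g, t s φ g = q ^ (∑ r, θ s r * g r) * φ (g + Pi.single s 1) := fun _ _ _ => rfl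
  refine ⟨Module.End K ((σ → ℤ) → K), inferInstance, inferInstance, t, inferInstance, ?_, ?_⟩
  · intro s
    rw [Module.End.isUnit_iff]
    constructor
    · rw [injective_iff_map_eq_zero]
      intro φ h
      ext g
      have h2 := congrFun h (g - Pi.single s 1)
      rw [ht, sub_add_cancel] at h2
      exact (mul_eq_zero.1 h2).resolve_left (zpow_ne_zero _ hq)
    · intro φ
      refine ⟨fun g => (q ^ (∑ r, θ s r * (g - Pi.single s 1 : σ → ℤ) r))⁻¹ * φ (g - Pi.single s 1), ?_⟩
      ext g
      rw [ht, add_sub_cancel_right, ← mul_assoc, mul_inv_cancel₀ (zpow_ne_zero _ hq), one_mul]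
  · intro s r
    have e : ∀ s r : σ, ∀ g : σ → ℤ, ∑ x, θ r x * (g + Pi.single s 1 : σ → ℤ) x = ∑ x, θ r x * g x + θ r s := by
      intro s r g
      simp [mul_add, Finset.sum_add_distrib, Pi.single_apply]
    ext φ g
    simp only [Module.End.mul_apply, LinearMap.smul_apply, Pi.smul_apply, smul_eq_mul, ht, e]
    rw [add_right_comm, ← mul_assoc, ← mul_assoc, ← mul_assoc, ← zpow_add₀ hq, ← zpow_add₀ hq,
      ← zpow_add₀ hq]
    congr 2
    ring

variable {C : Type*} [Ring C] [Algebra K C] {ι κ : Type*} [LinearOrder ι] [LinearOrder κ]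

/-- Elementary factor matrix. -/
def bandN (c : κ → ι) (a b : κ) (y : ι → C) (z : κ → C) (k : ι) (j : κ) : C :=
  if j < a then (if k = c j then 1 else 0) else if j ≤ b ∧ c j ≤ k then y k * z j else 0

lemma bandN_isQM {q : K} (hq : q ≠ 0) (c : κ → ι) (hc : StrictMono c) (a b : κ) (y : ι → C)
    (z : κ → C)
    (yy : ∀ k k', k < k' → y k * y k' = q • (y k' * y k))
    (zz : ∀ k k', k < k' → z k * z k' = q • (z k' * z k))
    (zy1 : ∀ l k, c l ≤ k → z l * y k = q⁻¹ • (y k * z l))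
    (zy2 : ∀ l k, k < c l → z l * y k = q • (y k * z l)) : IsQM q (bandN c a b y z) := by
  have m1 : ∀ k k' j l, c j ≤ k' → y k * z j * (y k' * z l) = q⁻¹ • (y k * y k' * (z j * z l)) := by
    intro k k' j l h
    rw [mul_assoc, ← mul_assoc (z j), zy1 _ _ h]
    simp only [smul_mul_assoc, mul_smul_comm, mul_assoc]
  have m2 : ∀ k k' j l, k' < c j → y k * z j * (y k' * z l) = q • (y k * y k' * (z j * z l)) := by
    intro k k' j l h
    rw [mul_assoc, ← mul_assoc (z j), zy2 _ _ h]
    simp only [smul_mul_assoc, mul_smul_comm, mul_assoc]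
  have comm1 : ∀ k j, j < a → ∀ w : C, Commute (bandN c a b y z k j) w := by
    intro k j h w
    unfold bandN
    rw [if_pos h]
    split_ifs
    · exact Commute.one_left _
    · exact Commute.zero_left _
  have zero1 : ∀ k j, k < c j → bandN c a b y z k j = 0 := by
    intro k j h
    unfold bandN
    have h2 : ¬ (j ≤ b ∧ c j ≤ k) := fun h' => absurd h'.2 (not_le.2 h)
    rw [if_neg h.ne, if_neg h2]
    simp
  have zero2 : ∀ k j, ¬ j < a → b < j → bandN c a b y z k j = 0 := by
    intro k j h h'
    unfold bandN
    rw [if_neg h, if_neg (fun h2 => absurd h2.1 (not_le.2 h'))]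
  have val : ∀ k j, ¬ j < a → ¬ b < j → ¬ k < c j → bandN c a b y z k j = y k * z j := by
    intro k j h h' h2
    unfold bandN
    rw [if_neg h, if_pos ⟨not_lt.1 h', not_lt.1 h2⟩]
  have val0 : ∀ k j, j < a → k ≠ c j → bandN c a b y z k j = 0 := by
    intro k j h h'
    unfold bandN
    rw [if_pos h, if_neg h']
  apply IsQM.of_rel hq
  · intro k j l hjl
    by_cases h1 : k < c l
    · rw [zero1 _ _ h1]; simp
    by_cases h2 : j < a
    · rw [val0 k j h2 (by
        rintro rfl
        exact h1 (hc hjl))]; simp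
    have h3 : ¬ l < a := fun h => h2 (hjl.trans h)
    by_cases h4 : b < l
    · rw [zero2 _ _ h3 h4]; simp
    have h5 : ¬ b < j := fun h => h4 (h.trans hjl)
    have h6 : ¬ k < c j := fun h => h1 (h.trans (hc hjl))
    rw [val _ _ h2 h5 h6, val _ _ h3 h4 h1, m1 _ _ _ _ (not_lt.1 h6), m1 _ _ _ _ (not_lt.1 h1),
      zz _ _ hjl]
    simp only [mul_smul_comm, smul_smul]
    congr 1; ring
  · intro k k' j hk
    by_cases h1 : j < a
    · by_cases h2 : k = c j
      · rw [val0 k' j h1 (by rw [← h2]; exact hk.ne')]; simp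
      · rw [val0 k j h1 h2]; simp
    by_cases h2 : b < j
    · rw [zero2 _ _ h1 h2]; simp
    by_cases h3 : k < c j
    · rw [zero1 _ _ h3]; simp
    have h4 : ¬ k' < c j := fun h => h3 (hk.trans h)
    rw [val _ _ h1 h2 h3, val _ _ h1 h2 h4, m1 _ _ _ _ (not_lt.1 h3), m1 _ _ _ _ (not_lt.1 h4),
      yy _ _ hk]
    simp only [smul_mul_assoc, smul_smul]
    congr 1; ring
  · intro k k' j l hk hjl
    by_cases h1 : j < a
    · exact (comm1 k j h1 _).eq
    have h3 : ¬ l < a := fun h => h1 (hjl.trans h)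
    by_cases h4 : b < l
    · rw [zero2 _ _ h3 h4]; simp
    have h5 : ¬ b < j := fun h => h4 (h.trans hjl)
    by_cases h6 : k' < c l
    · rw [zero1 _ _ h6]; simp
    have h7 : ¬ k < c j := fun h => h6 (hk.trans (h.trans (hc hjl)))
    have h8 : ¬ k' < c j := fun h => h6 (h.trans (hc hjl))
    have h9 : ¬ k < c l := fun h => h6 (hk.trans h)
    rw [val _ _ h1 h5 h7, val _ _ h3 h4 h6, m1 _ _ _ _ (not_lt.1 h8), m1 _ _ _ _ (not_lt.1 h9),
      yy _ _ hk, zz _ _ hjl]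
    simp only [smul_mul_assoc, mul_smul_comm]
  · intro k k' j l hk hjl
    by_cases h1 : j < a
    · rw [(comm1 k j h1 _).eq, sub_self]
      by_cases h2 : k' = c j
      · rw [zero1 k l (by rw [h2] at hk; exact hk.trans (hc hjl))]; simp
      · rw [val0 k' j h1 h2]; simp
    have h3 : ¬ l < a := fun h => h1 (hjl.trans h)
    by_cases h4 : b < l
    · rw [zero2 _ l h3 h4, zero2 _ l h3 h4]; simp
    have h5 : ¬ b < j := fun h => h4 (h.trans hjl)
    by_cases h6 : k' < c l
    · rw [zero1 _ _ h6, zero1 k l (hk.trans h6)]; simp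
    by_cases h7 : k < c j
    · rw [zero1 _ _ h7, zero1 k l (h7.trans (hc hjl))]; simp
    have h8 : ¬ k' < c j := fun h => h7 (hk.trans h)
    rw [val _ _ h1 h5 h7, val _ _ h3 h4 h6, val _ _ h1 h5 h8, m1 _ _ _ _ (not_lt.1 h8)]
    by_cases h9 : k < c l
    · rw [zero1 _ _ h9, m2 _ _ _ _ h9, yy _ _ hk, zz _ _ hjl]
      simp only [smul_mul_assoc, mul_smul_comm, smul_smul, zero_mul, smul_zero]
      rw [← sub_smul]
      have : q⁻¹ * (q * q) - q = 0 := by field_simp; ring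
      rw [this, zero_smul]
    · rw [val _ _ h3 h4 h9, m1 _ _ _ _ (not_lt.1 h9), m1 _ _ _ _ (not_lt.1 h6), yy _ _ hk, zz _ _ hjl]
      simp only [smul_mul_assoc, mul_smul_comm, smul_smul]
      rw [← sub_smul]
      congr 1
      field_simp

end Band
end QG

namespace QG
section Band2
universe u
variable {K : Type u} [Field K]

/-- Block matrix with an extra entry one in the corner. -/
def blockX {A : Type*} [Ring A] {m n : ℕ} (x : Fin m → Fin n → A) :
    Fin (m + 1) → Fin (n + 1) → A :=
  Fin.lastCases (Fin.lastCases 1 (fun _ => 0)) (fun k => Fin.lastCases 0 (fun p => x k p))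

lemma blockX_isQM {A : Type*} [Ring A] [Algebra K A] {q : K} {m n : ℕ} {x : Fin m → Fin n → A}
    (hx : IsQM q x) : IsQM q (blockX x) := by
  have a1 : ∀ {t : ℕ} (i k : Fin t), al q i.castSucc k.castSucc = al q i k := by
    intro t i k; simp [al]
  have a2 : ∀ {t : ℕ} (i : Fin t), al q i.castSucc (Fin.last t) = q - q⁻¹ := by
    intro t i; exact al_lt (Fin.castSucc_lt_last i)
  have a3 : ∀ {t : ℕ} (i : Fin t), al q (Fin.last t) i.castSucc = 0 := by
    intro t i; exact al_gt (Fin.castSucc_lt_last i)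
  intro i k j l
  induction i using Fin.lastCases <;> induction k using Fin.lastCases <;>
    induction j using Fin.lastCases <;> induction l using Fin.lastCases <;>
    simp [blockX, a1, a2, a3, al_self, hx _ _ _ _]

lemma exists_band {q : K} (hq : q ≠ 0) {n : ℕ} (m : ℕ) : ∀ (i j : Fin m → Fin n), StrictMono i →
    StrictMono j → (∀ k, i k ≤ j k) →
    ∃ (A : Type u) (_ : Ring A) (_ : Algebra K A) (x : Fin m → Fin n → A), Nontrivial A ∧ IsQM q x ∧
      (∀ k l, l < i k → x k l = 0) ∧ (∀ k l, j k < l → x k l = 0) ∧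
      (∀ k, IsUnit (x k (i k))) ∧ (∀ k, IsUnit (x k (j k))) := by
  induction m with
  | zero =>
    intro i j _ _ _
    exact ⟨K, inferInstance, inferInstance, fun k => k.elim0, inferInstance, fun k => k.elim0,
      fun k => k.elim0, fun k => k.elim0, fun k => k.elim0, fun k => k.elim0⟩
  | succ m ih =>
    intro i j hi hj hij
    obtain ⟨A, _, _, x, hA, hx, h1, h2, h3, h4⟩ := ih (fun k => i k.castSucc) (fun k => j k.castSucc)
      (fun a b h => hi (by simpa using h)) (fun a b h => hj (by simpa using h)) (fun k => hij _)
    set a := i (Fin.last m) with ha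
    set b := j (Fin.last m) with hb
    have hab : a ≤ b := hij _
    have hia : ∀ k : Fin m, i k.castSucc < a := fun k => hi (Fin.castSucc_lt_last k)
    have hjb : ∀ k : Fin m, j k.castSucc < b := fun k => hj (Fin.castSucc_lt_last k)
    let θ : Fin (n + 1) ⊕ Fin n → Fin (n + 1) ⊕ Fin n → ℤ := fun s r =>
      match s, r with
      | Sum.inl k, Sum.inl k' => if k' < k then 1 else 0
      | Sum.inr k, Sum.inr k' => if k' < k then 1 else 0
      | Sum.inl _, Sum.inr _ => 0
      | Sum.inr l, Sum.inl k => if l.castSucc ≤ k then 1 else -1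
    obtain ⟨C, _, _, t, hC, tu, tc⟩ := exists_torus hq θ
    have hN : IsQM q (bandN Fin.castSucc a b (fun k => t (Sum.inl k)) (fun k => t (Sum.inr k))) := by
      apply bandN_isQM hq _ Fin.strictMono_castSucc
      · intro k k' h
        have := tc (Sum.inl k) (Sum.inl k')
        simpa [θ, h, h.le, h.not_gt] using this
      · intro k k' h
        have := tc (Sum.inr k) (Sum.inr k')
        simpa [θ, h, h.le, h.not_gt] using this
      · intro l k h
        have := tc (Sum.inr l) (Sum.inl k)
        simpa [θ, h] using this
      · intro l k h
        have := tc (Sum.inr l) (Sum.inl k)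
        simpa [θ, not_le.2 h] using this
    set N := bandN Fin.castSucc a b (fun k => t (Sum.inl k)) (fun k => t (Sum.inr k)) with hNdef
    obtain ⟨Z, _, _, inl, inr, hlr, -, hnt⟩ := tensor_pack K A C
    have hX := IsQM.mul ((blockX_isQM hx).map inl) (hN.map inr) (fun i p r j => (hlr _ _).symm)
    set Y : Fin (m + 1) → Fin n → Z := fun i j => ∑ p, inl (blockX x i p) * inr (N p j) with hY
    have Ylast : ∀ l, Y (Fin.last m) l = inr (N (Fin.last n) l) := by
      intro l
      simp [hY, Fin.sum_univ_castSucc, blockX]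
    have Ycast : ∀ (k : Fin m) l, Y k.castSucc l = ∑ p : Fin n, inl (x k p) * inr (N p.castSucc l) := by
      intro k l
      simp [hY, Fin.sum_univ_castSucc, blockX]
    have YcastLt : ∀ (k : Fin m) l, l < a → Y k.castSucc l = inl (x k l) := by
      intro k l hl
      rw [Ycast, Finset.sum_eq_single l]
      · simp [hNdef, bandN, hl]
      · intro p _ hp
        simp [hNdef, bandN, hl, hp]
      · simp
    have unitN : ∀ (k : Fin (n + 1)) l, ¬ l < a → l ≤ b → l.castSucc ≤ k → IsUnit (inr (N k l)) := by
      intro k l hl hl2 hk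
      rw [hNdef, bandN, if_neg hl, if_pos ⟨hl2, hk⟩]
      exact ((tu _).mul (tu _)).map inr
    refine ⟨Z, inferInstance, inferInstance, Y, hnt hA hC, hX, ?_, ?_, ?_, ?_⟩
    · intro k l hl
      induction k using Fin.lastCases with
      | last =>
        rw [Ylast, hNdef, bandN, if_pos hl, if_neg (Fin.castSucc_lt_last l).ne', map_zero]
      | cast k =>
        rw [YcastLt k l (hl.trans (hia k)), h1 k l hl, map_zero]
    · intro k l hl
      induction k using Fin.lastCases with
      | last =>
        have e1 : ¬ l < a := fun h => absurd (h.trans_le hab) (not_lt.2 hl.le)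
        have e2 : ¬ (l ≤ b ∧ l.castSucc ≤ Fin.last n) := fun h => absurd h.1 (not_le.2 hl)
        rw [Ylast, hNdef, bandN, if_neg e1, if_neg e2, map_zero]
      | cast k =>
        by_cases hla : l < a
        · rw [YcastLt k l hla, h2 k l hl, map_zero]
        · rw [Ycast]
          refine Finset.sum_eq_zero fun p _ => ?_
          by_cases hp : l ≤ p
          · rw [h2 k p (hl.trans_le hp), map_zero, zero_mul]
          · have e2 : ¬ (l ≤ b ∧ l.castSucc ≤ p.castSucc) := fun h => hp (by simpa using h.2)
            rw [hNdef, bandN, if_neg hla, if_neg e2, map_zero, mul_zero]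
    · intro k
      induction k using Fin.lastCases with
      | last =>
        rw [Ylast]
        exact unitN _ _ (lt_irrefl _) hab (Fin.le_last _)
      | cast k =>
        rw [YcastLt k _ (hia k)]
        exact (h3 k).map inl
    · intro k
      induction k using Fin.lastCases with
      | last =>
        rw [Ylast]
        exact unitN _ _ (not_lt.2 hab) le_rfl (Fin.le_last _)
      | cast k =>
        by_cases hla : j k.castSucc < a
        · rw [YcastLt k _ hla]
          exact (h4 k).map inl
        · rw [Ycast, Finset.sum_eq_single (j k.castSucc)]
          · exact ((h4 k).map inl).mul (unitN _ _ hla (hjb k).le le_rfl)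
          · intro p _ hp
            rcases lt_or_gt_of_ne hp with hp | hp
            · have e2 : ¬ (j k.castSucc ≤ b ∧ (j k.castSucc).castSucc ≤ p.castSucc) :=
                fun h => absurd (by simpa using h.2) (not_le.2 hp)
              rw [hNdef, bandN, if_neg hla, if_neg e2, map_zero, mul_zero]
            · rw [h2 k p hp, map_zero, zero_mul]
          · simp

end Band2
end QG

namespace QG
section Indep
universe u

lemma perm_eq_one_of_le {m : ℕ} (σ : Equiv.Perm (Fin m)) (h : ∀ k, σ k ≤ k) : σ = 1 := by
  have h1 : ∑ k, ((σ k : Fin m) : ℕ) = ∑ k : Fin m, (k : ℕ) :=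
    Equiv.sum_comp σ (fun k : Fin m => (k : ℕ))
  rw [Finset.sum_eq_sum_iff_of_le (fun k _ => Fin.val_le_of_le (h k))] at h1
  ext k
  exact h1 k (Finset.mem_univ _)

lemma perm_eq_one_of_ge {m : ℕ} (σ : Equiv.Perm (Fin m)) (h : ∀ k, k ≤ σ k) : σ = 1 := by
  have h1 : ∑ k : Fin m, (k : ℕ) = ∑ k, ((σ k : Fin m) : ℕ) :=
    (Equiv.sum_comp σ (fun k : Fin m => (k : ℕ))).symm
  rw [Finset.sum_eq_sum_iff_of_le (fun k _ => Fin.val_le_of_le (h k))] at h1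
  ext k
  exact (h1 k (Finset.mem_univ _)).symm

lemma qMinor_isUnit {K : Type*} [Field K] {A : Type*} [Ring A] [Algebra K A] (q : K) (m : ℕ)
    (y : Fin m → Fin m → A) (h : ∀ σ : Equiv.Perm (Fin m), σ ≠ 1 → ∃ k, y (σ k) k = 0)
    (hu : ∀ k, IsUnit (y k k)) : IsUnit (qMinor K q m y) := by
  rw [qMinor, Finset.sum_eq_single 1]
  · have : invCount (1 : Equiv.Perm (Fin m)) = 0 := by
      rw [invCount, Finset.card_eq_zero, Finset.filter_eq_empty_iff]
      rintro ⟨a, b⟩ _ ⟨h1, h2⟩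
      exact lt_asymm h1 h2
    rw [this, pow_zero, one_smul]
    apply List.prod_isUnit
    intro z hz
    rw [List.mem_ofFn] at hz
    obtain ⟨k, rfl⟩ := hz
    exact hu k
  · intro σ _ hσ
    obtain ⟨k, hk⟩ := h σ hσ
    rw [List.prod_eq_zero, smul_zero]
    rw [List.mem_ofFn]
    exact ⟨k, hk⟩
  · simp

lemma gMinor_ne_zero {K : Type*} [Field K] {A : Type*} [Ring A] [Algebra K A] {q : K} {m n : ℕ}
    {x : Fin m → Fin n → A} {i j : Fin m → Fin n} (h1 : ∀ k l, l < i k → x k l = 0)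
    (h2 : ∀ k l, j k < l → x k l = 0) {J : Finset (Fin n)} (hJ : J.card = m)
    (h : gMinor q x J ≠ 0) : ∃ σ : Equiv.Perm (Fin m), ∀ k,
      i (σ k) ≤ J.orderEmbOfFin hJ k ∧ J.orderEmbOfFin hJ k ≤ j (σ k) := by
  by_contra hcon
  apply h
  rw [gMinor, dif_pos hJ, qMinor]
  refine Finset.sum_eq_zero fun σ _ => ?_
  have : ¬ ∀ k, i (σ k) ≤ J.orderEmbOfFin hJ k ∧ J.orderEmbOfFin hJ k ≤ j (σ k) :=
    fun h => hcon ⟨σ, h⟩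
  obtain ⟨k, hk⟩ := not_forall.1 this
  rw [List.prod_eq_zero, smul_zero]
  rw [List.mem_ofFn]
  refine ⟨k, ?_⟩
  by_cases h3 : i (σ k) ≤ J.orderEmbOfFin hJ k
  · exact h2 _ _ (not_le.1 fun h4 => hk ⟨h3, h4⟩)
  · exact h1 _ _ (not_le.1 h3)

lemma sum_orderEmb {m n : ℕ} (J : Finset (Fin n)) (hJ : J.card = m) :
    ∑ k, ((J.orderEmbOfFin hJ k : Fin n) : ℕ) = ∑ s ∈ J, (s : ℕ) := by
  have : Finset.univ.map (J.orderEmbOfFin hJ).toEmbedding = J := by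
    ext a
    have := Finset.range_orderEmbOfFin J hJ
    have h2 : a ∈ Set.range (J.orderEmbOfFin hJ) ↔ a ∈ (J : Set (Fin n)) := by rw [this]
    simp
  conv_rhs => rw [← this]
  rw [Finset.sum_map]
  rfl

/-- comparing with the lower boundary -/
lemma sum_le_of_perm {m n : ℕ} (I J : Finset (Fin n)) (hI : I.card = m) (hJ : J.card = m)
    (σ : Equiv.Perm (Fin m)) (h : ∀ k, I.orderEmbOfFin hI (σ k) ≤ J.orderEmbOfFin hJ k) :
    ∑ s ∈ I, (s : ℕ) ≤ ∑ s ∈ J, (s : ℕ) ∧ (∑ s ∈ I, (s : ℕ) = ∑ s ∈ J, (s : ℕ) → I = J) := by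
  rw [← sum_orderEmb I hI, ← sum_orderEmb J hJ,
    ← Equiv.sum_comp σ (fun k => ((I.orderEmbOfFin hI k : Fin n) : ℕ))]
  refine ⟨Finset.sum_le_sum fun k _ => h k, fun he => ?_⟩
  rw [Finset.sum_eq_sum_iff_of_le (fun k _ => Fin.val_le_of_le (h k))] at he
  symm
  apply Finset.eq_of_subset_of_card_le _ (by rw [hI, hJ])
  intro a ha
  have h2 : a ∈ Set.range (J.orderEmbOfFin hJ) := by
    rw [Finset.range_orderEmbOfFin]; exact ha
  obtain ⟨k, rfl⟩ := h2
  have h3 := he k (Finset.mem_univ _)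
  rw [← Fin.ext h3]
  exact Finset.orderEmbOfFin_mem _ _ _

lemma std_le {m n : ℕ} {I J : Finset (Fin n)} (hI : I.card = m) (hJ : J.card = m)
    (h : ∀ x, (J.filter (· ≤ x)).card ≤ (I.filter (· ≤ x)).card) (k : Fin m) :
    I.orderEmbOfFin hI k ≤ J.orderEmbOfFin hJ k := by
  by_contra hcon
  rw [not_le] at hcon
  have h1 := h (J.orderEmbOfFin hJ k)
  have h2 : (Finset.Iic k).map (J.orderEmbOfFin hJ).toEmbedding ⊆
      J.filter (· ≤ J.orderEmbOfFin hJ k) := by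
    intro a ha
    rw [Finset.mem_map] at ha
    obtain ⟨l, hl, rfl⟩ := ha
    rw [Finset.mem_filter]
    exact ⟨Finset.orderEmbOfFin_mem _ _ _, (J.orderEmbOfFin hJ).monotone (Finset.mem_Iic.1 hl)⟩
  have h3 : I.filter (· ≤ J.orderEmbOfFin hJ k) ⊆
      (Finset.Iio k).map (I.orderEmbOfFin hI).toEmbedding := by
    intro a ha
    rw [Finset.mem_filter] at ha
    have h4 : a ∈ Set.range (I.orderEmbOfFin hI) := by
      rw [Finset.range_orderEmbOfFin]; exact ha.1
    obtain ⟨l, rfl⟩ := h4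
    rw [Finset.mem_map]
    refine ⟨l, ?_, rfl⟩
    rw [Finset.mem_Iio]
    exact (I.orderEmbOfFin hI).lt_iff_lt.1 (ha.2.trans_lt hcon)
  have h5 := Finset.card_le_card h2
  have h6 := Finset.card_le_card h3
  rw [Finset.card_map, Fin.card_Iic] at h5
  rw [Finset.card_map, Fin.card_Iio] at h6
  omega

lemma exists_hom {K : Type*} [Field K] {A : Type*} [Ring A] [Algebra K A] {q : K} (hq : q ≠ 0)
    {m n : ℕ} {x : Fin m → Fin n → A} (hx : IsQM q x) :
    ∃ φ : QMat K q m n →ₐ[K] A, ∀ i j, φ (X K q i j) = x i j := by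
  refine ⟨RingQuot.liftAlgHom K ⟨FreeAlgebra.lift K (fun p => x p.1 p.2), ?_⟩, ?_⟩
  · intro a b h
    cases h with
    | row i j l h => simpa using hx.row hq h
    | col i k j h => simpa using hx.col hq h
    | comm i k j l h h' => simpa using hx.comm h h'
    | qrel i k j l h h' =>
      have := hx.qrel h h'
      simp only [map_sub, map_mul, map_smul, FreeAlgebra.lift_ι_apply]
      rw [this, add_sub_cancel_left]
  · intro i j
    simp [X]

lemma indep {K : Type u} [Field K] {q : K} (hq : q ≠ 0) (m n : ℕ)
    (v : (Finset (Fin n) × Finset (Fin n)) →₀ K)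
    (hv : v ∈ Finsupp.supported K K {T | IsStd m T})
    (h0 : Finsupp.linearCombination K (fun T : Finset (Fin n) × Finset (Fin n) =>
      grMinor K q m T.1 * grMinor K q m T.2) v = 0) : v = 0 := by
  by_contra hne
  have hsup : v.support.Nonempty := Finsupp.support_nonempty_iff.2 hne
  obtain ⟨⟨I, J⟩, hT, hmin⟩ := Finset.exists_min_image v.support
    (fun T => (∑ s ∈ T.2, ((s : ℕ) : ℤ)) - ∑ s ∈ T.1, ((s : ℕ) : ℤ)) hsup
  rw [Finsupp.mem_supported] at hv
  obtain ⟨hI, hJ, hs⟩ := hv hT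
  simp only at hI hJ hs
  obtain ⟨A, _, _, x, hA, hx, h1, h2, h3, h4⟩ := exists_band hq m (I.orderEmbOfFin hI)
    (J.orderEmbOfFin hJ) (I.orderEmbOfFin hI).strictMono (J.orderEmbOfFin hJ).strictMono
    (std_le hI hJ hs)
  obtain ⟨φ, hφ⟩ := exists_hom hq hx
  have hg : ∀ U : Finset (Fin n), φ (grMinor K q m U) = gMinor q x U := by
    intro U
    have := gMinor_map φ q (fun i j => X K q i j) U
    simp only [hφ] at this
    exact this
  have h5 := congrArg φ h0
  rw [Finsupp.linearCombination_apply, Finsupp.sum, map_sum, map_zero,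
    Finset.sum_eq_single (I, J)] at h5
  · rw [map_smul, map_mul, hg, hg] at h5
    have u1 : IsUnit (gMinor q x I) := by
      rw [gMinor, dif_pos hI]
      apply qMinor_isUnit
      · intro σ hσ
        by_contra hcon
        push Not at hcon
        apply hσ
        apply perm_eq_one_of_le
        intro k
        by_contra hk
        exact hcon k (h1 _ _ ((I.orderEmbOfFin hI).strictMono (not_le.1 hk)))
      · exact h3
    have u2 : IsUnit (gMinor q x J) := by
      rw [gMinor, dif_pos hJ]
      apply qMinor_isUnit
      · intro σ hσ
        by_contra hcon
        push Not at hcon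
        apply hσ
        apply perm_eq_one_of_ge
        intro k
        by_contra hk
        exact hcon k (h2 _ _ ((J.orderEmbOfFin hJ).strictMono (not_le.1 hk)))
      · exact h4
    have u3 := (u1.mul u2).ne_zero
    exact (smul_ne_zero (Finsupp.mem_support_iff.1 hT) u3) h5
  · rintro ⟨I', J'⟩ hT' hne'
    rw [map_smul, map_mul, hg, hg]
    by_contra hnz
    have n1 : gMinor q x I' ≠ 0 := by
      intro h; apply hnz; simp [h]
    have n2 : gMinor q x J' ≠ 0 := by
      intro h; apply hnz; simp [h]
    obtain ⟨hI', hJ', -⟩ := hv hT'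
    simp only at hI' hJ'
    obtain ⟨σ, hσ⟩ := gMinor_ne_zero h1 h2 hI' n1
    obtain ⟨τ, hτ⟩ := gMinor_ne_zero h1 h2 hJ' n2
    obtain ⟨a1, a2⟩ := sum_le_of_perm I I' hI hI' σ (fun k => (hσ k).1)
    obtain ⟨b1, b2⟩ := sum_le_of_perm J' J hJ' hJ τ.symm (fun k => by
      have := (hτ (τ.symm k)).2
      simpa using this)
    have hm := hmin _ hT'
    simp only [← Nat.cast_sum] at hm
    have c1 : ∑ s ∈ I, (s : ℕ) = ∑ s ∈ I', (s : ℕ) := by omega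
    have c2 : ∑ s ∈ J', (s : ℕ) = ∑ s ∈ J, (s : ℕ) := by omega
    exact hne' (by rw [a2 c1, b2 c2])
  · intro h; exact absurd hT h

lemma muir_main {K : Type*} [Field K] {q : K} (hq : q ≠ 0) (m n : ℕ)
    (d : ℕ) (I J : Fin d → Finset (Fin n)) (c : Fin d → K)
    (hI : ∀ s, (I s).card = m) (hJ : ∀ s, (J s).card = m)
    (h0 : ∑ s, c s • (grMinor K q m (I s) * grMinor K q m (J s)) = 0)
    (P : Finset (Fin n)) (hIP : ∀ s, I s ⊆ P) (hJP : ∀ s, J s ⊆ P) :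
    ∑ s, c s • (grMinor K q (m + Pᶜ.card) (I s ∪ Pᶜ) *
        grMinor K q (m + Pᶜ.card) (J s ∪ Pᶜ)) = 0 := by
  have hu : ∑ s, c s • Finsupp.single (I s, J s) (1 : K) ∈
      Plk q m n ⊔ Finsupp.supported K K {T | IsStd m T} :=
    Submodule.sum_mem _ fun s _ => Submodule.smul_mem _ _
      (straighten hq m n _ _ _ (hI s) (hJ s) rfl)
  obtain ⟨p, hp, v, hv, hpv⟩ := Submodule.mem_sup.1 hu
  have h1 := congrArg (Finsupp.linearCombination K (fun T : Finset (Fin n) × Finset (Fin n) =>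
      grMinor K q m T.1 * grMinor K q m T.2)) hpv
  rw [map_add, phi_f_kills hq m n p hp, zero_add, map_sum] at h1
  simp only [map_smul, Finsupp.linearCombination_single, one_smul] at h1
  rw [h0] at h1
  have hv0 := indep hq m n v hv h1
  rw [hv0, add_zero] at hpv
  have h2 := phi_g_kills hq m n P p hp
  rw [hpv, map_sum] at h2
  simp only [map_smul, Finsupp.linearCombination_single, one_smul] at h2
  rw [← h2]
  refine Finset.sum_congr rfl fun s _ => ?_
  rw [if_pos (Finset.union_subset (hIP s) (hJP s))]

end Indep
end QG

namespace QG

open scoped BigOperators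

/-- (Quantum Muir's law of extensible minors, grassmannian version.)
If `Σ_s c_s [I_s][J_s] = 0` in `O_q(G(m,n))` and `P ⊆ {1,…,n}` contains all the `I_s`
and `J_s`, then, with `P̄` the complement of `P` and `m' = m + |P̄|`,
`Σ_s c_s [I_s ⊔ P̄][J_s ⊔ P̄] = 0` holds in `O_q(G(m',n))`. -/
theorem quantum_muir_extensible_minors
    (K : Type*) [Field K] (q : K) (hq : q ≠ 0) (m n : ℕ) (hm : 0 < m) (hmn : m < n)
    (d : ℕ) (I J : Fin d → Finset (Fin n)) (c : Fin d → K)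
    (hI : ∀ s, (I s).card = m) (hJ : ∀ s, (J s).card = m)
    (h0 : ∑ s, c s • (grMinor K q m (I s) * grMinor K q m (J s)) = 0)
    (P : Finset (Fin n)) (hIP : ∀ s, I s ⊆ P) (hJP : ∀ s, J s ⊆ P) :
    ∑ s, c s • (grMinor K q (m + Pᶜ.card) (I s ∪ Pᶜ) *
        grMinor K q (m + Pᶜ.card) (J s ∪ Pᶜ)) = 0 := by
  exact muir_main hq m n d I J c hI hJ h0 P hIP hJP

end QG
end
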